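/- arXiv:2512.07460 — 2 statements merged into one kernel-verified Lean document; each statement's English description precedes it below -/
import Mathlib

section
/- Let D ⋐ ℂ^m be a bounded symmetric domain equipped with a canonical Kähler metric g'_D = Σ_{j=1}^k λ_j Pr_j^* g_{D_j} (λ_j > 0). Then the real-analytic function φ_m(w) = det((g'_D)_{s\bar t}(w))_{1≤s,t≤m} on D does not lie in the Umehara algebra Λ(D). -/
open scoped Classical ComplexOrder
open Complex Set

noncomputable section

/-- Holomorphic Jacobian entry ∂F_i/∂w_l at w. -/
def Jac {m : ℕ} {ι : Type*} (F : (Fin m → ℂ) → ι → ℂ) (w : Fin m → ℂ) (i : ι) (l : Fin m) : ℂ :=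
  fderiv ℂ (fun w' => F w' i) w (Pi.single l 1)

/-- A Hermitian metric on an open set `U` of the coordinate space `ι → ℂ`, given by its matrix of
coefficients `g_{i j̄}`: Hermitian, positive definite and smooth on `U`. -/
structure HermMetricOn {ι : Type*} [Fintype ι] [DecidableEq ι] (U : Set (ι → ℂ)) where
  g : (ι → ℂ) → Matrix ι ι ℂ
  isHermitian : ∀ z ∈ U, (g z).IsHermitian
  posDef : ∀ z ∈ U, (g z).PosDef
  smooth : ∀ i j, ContDiffOn ℝ (⊤ : ℕ∞) (fun z => g z i j) U

/-- The matrix of coefficients of the pullback `F^*ω_N` of the Hermitian form with matrix `gN`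
under a holomorphic map `F`:  `(F^*ω_N)_{l k̄} = Σ_{i,j} (g_N)_{i j̄}(F w) ∂F_i/∂w_l conj(∂F_j/∂w_k)`. -/
def pullbackMetric {m : ℕ} {ι : Type*} [Fintype ι]
    (gN : (ι → ℂ) → Matrix ι ι ℂ) (F : (Fin m → ℂ) → ι → ℂ) (w : Fin m → ℂ) :
    Matrix (Fin m) (Fin m) ℂ :=
  Matrix.of fun l k => ∑ i, ∑ j, gN (F w) i j * Jac F w i l * (starRingEnd ℂ) (Jac F w j k)

/-- `F^*ω_N^p = λ ω_M^p` on `V`, expressed in coordinates: all corresponding `p×p` minors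
(the coefficients of the two (p,p)-forms on increasing multi-indices) agree up to the factor λ. -/
def PreservesPP {m : ℕ} {ι : Type*} [Fintype ι]
    (gM : (Fin m → ℂ) → Matrix (Fin m) (Fin m) ℂ) (gN : (ι → ℂ) → Matrix ι ι ℂ)
    (F : (Fin m → ℂ) → ι → ℂ) (V : Set (Fin m → ℂ)) (p : ℕ) (lam : ℝ) : Prop :=
  ∀ w ∈ V, ∀ L K : Fin p → Fin m, StrictMono L → StrictMono K →
    ((pullbackMetric gN F w).submatrix L K).det = (lam : ℂ) * ((gM w).submatrix L K).det

/-- Wirtinger derivative ∂/∂z_k of a function of several complex variables. -/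
def wdz {ι : Type*} [Fintype ι] [DecidableEq ι] (k : ι) (f : (ι → ℂ) → ℂ) (z : ι → ℂ) : ℂ :=
  (fderiv ℝ f z (Pi.single k 1) - Complex.I * fderiv ℝ f z (Pi.single k Complex.I)) / 2

/-- Conjugate Wirtinger derivative ∂/∂z̄_k. -/
def wdzbar {ι : Type*} [Fintype ι] [DecidableEq ι] (k : ι) (f : (ι → ℂ) → ℂ) (z : ι → ℂ) : ℂ :=
  (fderiv ℝ f z (Pi.single k 1) + Complex.I * fderiv ℝ f z (Pi.single k Complex.I)) / 2

/-- A bounded symmetric domain in `ℂ^m`: a bounded connected open set such that every point is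
an isolated fixed point of a holomorphic involution of the domain. -/
structure IsBddSymmDomain {m : ℕ} (D : Set (Fin m → ℂ)) : Prop where
  isOpen : IsOpen D
  isConnected : IsConnected D
  isBounded : Bornology.IsBounded D
  symm : ∀ x ∈ D, ∃ σ : (Fin m → ℂ) → (Fin m → ℂ),
    DifferentiableOn ℂ σ D ∧ Set.MapsTo σ D D ∧ (∀ z ∈ D, σ (σ z) = z) ∧ σ x = x ∧
    ∃ ε > 0, ∀ y ∈ D, dist y x < ε → σ y = y → y = x

/-- A canonical Kähler metric on a bounded symmetric domain `D`: a Kähler metric invariant under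
all automorphisms of `D`.  (For a bounded symmetric domain with irreducible factors `D_j` these
are exactly the metrics `Σ_j λ_j Pr_j^* g_{D_j}`, `λ_j > 0`.) -/
def IsCanonicalKahlerMetric {m : ℕ} (D : Set (Fin m → ℂ)) (G : HermMetricOn D) : Prop :=
  (∀ i j k, ∀ z ∈ D, wdz k (fun w => G.g w i j) z = wdz i (fun w => G.g w k j) z) ∧
  ∀ ψ : (Fin m → ℂ) → (Fin m → ℂ),
    DifferentiableOn ℂ ψ D → Set.MapsTo ψ D D →
    (∃ ψinv : (Fin m → ℂ) → (Fin m → ℂ), DifferentiableOn ℂ ψinv D ∧ Set.MapsTo ψinv D D ∧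
      (∀ z ∈ D, ψinv (ψ z) = z) ∧ (∀ z ∈ D, ψ (ψinv z) = z)) →
    ∀ z ∈ D, pullbackMetric G.g ψ z = G.g z

noncomputable section

/-- Membership in the Umehara algebra Λ(S): the (real-valued, viewed in ℂ) function φ is a finite
real linear combination of functions `f·conj(g) + g·conj(f)` with `f`, `g` holomorphic on `S`. -/
def UmeharaMem {E : Type*} [NormedAddCommGroup E] [NormedSpace ℂ E]
    (S : Set E) (φ : E → ℂ) : Prop :=
  ∃ (r : ℕ) (c : Fin r → ℝ) (f g : Fin r → E → ℂ),
    (∀ j, DifferentiableOn ℂ (f j) S) ∧ (∀ j, DifferentiableOn ℂ (g j) S) ∧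
    ∀ z ∈ S, φ z = ∑ j, (c j : ℂ) *
      (f j z * (starRingEnd ℂ) (g j z) + g j z * (starRingEnd ℂ) (f j z))

theorem exists_ball_bound {E F : Type*} [NormedAddCommGroup E] [NormedAddCommGroup F]
    {f : E → F} {U : Set E} (hU : IsOpen U) (hf : ContinuousOn f U) {a : E}
    (ha : a ∈ U) : ∃ R > 0, ∃ M, Metric.ball a R ⊆ U ∧ ∀ w ∈ Metric.ball a R, ‖f w‖ ≤ M := by
  have h1 : ∀ᶠ w in nhds a, ‖f w‖ < ‖f a‖ + 1 :=
    (hf.continuousAt (hU.mem_nhds ha)).norm.eventually_lt_const (by linarith)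
  obtain ⟨R, hR, h⟩ := Metric.eventually_nhds_iff_ball.1 (h1.and (hU.eventually_mem ha))
  exact ⟨R, hR, ‖f a‖ + 1, fun w hw => (h w hw).2, fun w hw => (h w hw).1.le⟩

section HolomorphicMaps

variable {E F : Type*} [NormedAddCommGroup E] [NormedSpace ℂ E] [NormedAddCommGroup F]
  [NormedSpace ℂ F]

theorem norm_sub_le_of_differentiableOn_ball {f : E → F} {c z : E} {R M : ℝ}
    (hf : DifferentiableOn ℂ f (Metric.ball c R)) (hM : ∀ w ∈ Metric.ball c R, ‖f w‖ ≤ M)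
    (hz : z ∈ Metric.ball c R) : ‖f z - f c‖ ≤ 2 * M / R * ‖z - c‖ := by
  have hR : 0 < R := Metric.pos_of_mem_ball hz
  have := Complex.dist_le_div_mul_dist_of_mapsTo_ball hf (R₂ := 2 * M) (fun w hw => by
    rw [Metric.mem_closedBall, dist_eq_norm]
    linarith [norm_sub_le (f w) (f c), hM w hw, hM c (Metric.mem_ball_self hR)]) hz
  simpa [dist_eq_norm] using this

theorem norm_fderiv_le_of_differentiableOn_ball {f : E → F} {c : E} {R M : ℝ} (hR : 0 < R)
    (hf : DifferentiableOn ℂ f (Metric.ball c R)) (hM : ∀ w ∈ Metric.ball c R, ‖f w‖ ≤ M) :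
    ‖fderiv ℂ f c‖ ≤ 2 * M / R := by
  refine Complex.norm_fderiv_le_div_of_mapsTo_ball hf (R₂ := 2 * M) (fun w hw => ?_) hR
  rw [Metric.mem_closedBall, dist_eq_norm]
  linarith [norm_sub_le (f w) (f c), hM w hw, hM c (Metric.mem_ball_self hR)]

/-- Second order Taylor estimate for a bounded holomorphic map. -/
theorem norm_sub_sub_fderiv_le {f : E → F} {c z : E} {R M : ℝ}
    (hf : DifferentiableOn ℂ f (Metric.ball c R)) (hM : ∀ w ∈ Metric.ball c R, ‖f w‖ ≤ M)
    (hz : z ∈ Metric.ball c R) :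
    ‖f z - f c - fderiv ℂ f c (z - c)‖ ≤ 4 * M * (‖z - c‖ / R) ^ 2 := by
  have hR : 0 < R := Metric.pos_of_mem_ball hz
  have hc := Metric.mem_ball_self (x := c) hR
  have hd : HasFDerivAt f (fderiv ℂ f c) c :=
    (hf.differentiableAt (Metric.isOpen_ball.mem_nhds hc)).hasFDerivAt
  have h1 := norm_fderiv_le_of_differentiableOn_ball hR hf hM
  have key := Complex.dist_le_mul_div_pow_of_mapsTo_ball_of_isLittleO
    (f := fun w => f w - fderiv ℂ f c (w - c)) (c := c) (z := z) (R₁ := R) (R₂ := 4 * M) (n := 1)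
    (hf.sub ((fderiv ℂ f c).differentiable.comp (differentiable_id.sub_const c)).differentiableOn)
    (fun w hw => by
      rw [Metric.mem_closedBall, dist_eq_norm]
      have h2 : ‖fderiv ℂ f c (w - c)‖ ≤ 2 * M := by
        refine ((fderiv ℂ f c).le_opNorm _).trans ?_
        have h3 : ‖w - c‖ ≤ R := by rw [← dist_eq_norm]; exact (Metric.mem_ball.1 hw).le
        calc _ ≤ (2 * M / R) * R :=
              mul_le_mul h1 h3 (norm_nonneg _) ((norm_nonneg _).trans h1)
          _ = 2 * M := by field_simp
      simp only [sub_self, map_zero, sub_zero]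
      calc ‖f w - fderiv ℂ f c (w - c) - f c‖
          ≤ ‖f w‖ + ‖fderiv ℂ f c (w - c)‖ + ‖f c‖ :=
            (norm_sub_le _ _).trans (by gcongr; exact norm_sub_le _ _)
        _ ≤ 4 * M := by linarith [hM w hw, hM c hc])
    (by
      have := hd.isLittleO
      simp only [sub_self, map_zero, sub_zero, pow_one]
      refine (this.congr_left fun w => ?_).norm_right
      abel) hz
  have e : f z - fderiv ℂ f c (z - c) - (f c - fderiv ℂ f c (c - c))
      = f z - f c - fderiv ℂ f c (z - c) := by
    simp only [sub_self, map_zero, sub_zero]; abel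
  simpa only [dist_eq_norm, e] using key

theorem differentiableAt_of_tendstoUniformlyOn_ball [CompleteSpace F] {f : ℕ → E → F} {g : E → F}
    {c : E} {R : ℝ} (hR : 0 < R) (hf : ∀ n, DifferentiableOn ℂ (f n) (Metric.ball c R))
    (hfg : TendstoUniformlyOn f g Filter.atTop (Metric.ball c R)) : DifferentiableAt ℂ g c := by
  have hsub : Metric.ball c (R / 2) ⊆ Metric.ball c R := Metric.ball_subset_ball (by linarith)
  have hball : ∀ z ∈ Metric.ball c (R / 2), Metric.ball z (R / 2) ⊆ Metric.ball c R :=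
    fun z hz => Metric.ball_subset_ball' (by rw [Metric.mem_ball] at hz; linarith)
  have hcau : UniformCauchySeqOn (fun n => fderiv ℂ (f n)) Filter.atTop
      (Metric.ball c (R / 2)) := by
    rw [Metric.uniformCauchySeqOn_iff]
    intro ε hε
    obtain ⟨N, hN⟩ := Metric.uniformCauchySeqOn_iff.1 hfg.uniformCauchySeqOn (ε * R / 8)
      (by positivity)
    refine ⟨N, fun m hm n hn z hz => ?_⟩
    have hd : ∀ k, DifferentiableAt ℂ (f k) z := fun k =>
      (hf k).differentiableAt (Metric.isOpen_ball.mem_nhds (hsub hz))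
    rw [dist_eq_norm, ← fderiv_sub (hd m) (hd n)]
    have := norm_fderiv_le_of_differentiableOn_ball (half_pos hR)
      (((hf m).sub (hf n)).mono (hball z hz)) (M := ε * R / 8) (fun w hw => by
        have := hN m hm n hn w (hball z hz hw)
        rw [dist_eq_norm] at this
        exact this.le)
    refine this.trans_lt ?_
    have : 2 * (ε * R / 8) / (R / 2) = ε / 2 := by field_simp; ring
    linarith
  have hlim : ∀ z ∈ Metric.ball c (R / 2), ∃ L, Filter.Tendsto (fun n => fderiv ℂ (f n) z)
      Filter.atTop (nhds L) := fun z hz => cauchySeq_tendsto_of_complete (hcau.cauchySeq hz)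
  choose! g' hg' using hlim
  exact (hasFDerivAt_of_tendstoUniformlyOn Metric.isOpen_ball
    (hcau.tendstoUniformlyOn_of_tendsto hg')
    (fun n x hx => ((hf n).differentiableAt (Metric.isOpen_ball.mem_nhds (hsub hx))).hasFDerivAt)
    (fun x hx => hfg.tendsto_at (hsub hx)) (Metric.mem_ball_self (half_pos hR))).differentiableAt

theorem DifferentiableOn.fderiv_apply_of_isOpen [CompleteSpace F] {f : E → F} {U : Set E}
    (hU : IsOpen U) (hf : DifferentiableOn ℂ f U) (v : E) :
    DifferentiableOn ℂ (fun z => fderiv ℂ f z v) U := by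
  intro a ha
  obtain ⟨R, hR, M, hRU, hM⟩ := exists_ball_bound hU hf.continuousOn ha
  have hfR := hf.mono hRU
  have hM0 : 0 ≤ M := (norm_nonneg _).trans (hM a (Metric.mem_ball_self hR))
  set r := R / 2 with hr
  have hr0 : 0 < r := half_pos hR
  set t : ℕ → ℝ := fun n => r / (‖v‖ + 1) * (1 / ((n : ℝ) + 1)) with ht
  have hv : 0 < ‖v‖ + 1 := by positivity
  have ht0 : ∀ n, 0 < t n := fun n => by positivity
  have htv : ∀ n, ‖(t n : ℂ) • v‖ < r := fun n => by
    rw [norm_smul, Complex.norm_real, Real.norm_of_nonneg (ht0 n).le]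
    have h1 : t n ≤ r / (‖v‖ + 1) := by
      refine mul_le_of_le_one_right (by positivity) ?_
      rw [div_le_one (by positivity)]; linarith [(Nat.cast_nonneg n : (0 : ℝ) ≤ n)]
    calc t n * ‖v‖ ≤ r / (‖v‖ + 1) * ‖v‖ := by gcongr
      _ < r / (‖v‖ + 1) * (‖v‖ + 1) := by gcongr; linarith
      _ = r := by field_simp
  have hsub : Metric.ball a r ⊆ Metric.ball a R := Metric.ball_subset_ball (by linarith)
  have hball : ∀ z ∈ Metric.ball a r, Metric.ball z r ⊆ Metric.ball a R :=
    fun z hz => Metric.ball_subset_ball' (by rw [Metric.mem_ball] at hz; linarith)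
  have hmem : ∀ n, ∀ z, z + (t n : ℂ) • v ∈ Metric.ball z r := fun n z => by
    rw [Metric.mem_ball, dist_eq_norm, add_sub_cancel_left]; exact htv n
  have htlim : Filter.Tendsto t Filter.atTop (nhds 0) := by
    simpa [ht] using (tendsto_one_div_add_atTop_nhds_zero_nat (𝕜 := ℝ)).const_mul (r / (‖v‖ + 1))
  refine (differentiableAt_of_tendstoUniformlyOn_ball hr0
    (f := fun n z => (t n : ℂ)⁻¹ • (f (z + (t n : ℂ) • v) - f z)) (fun n => ?_)
    ?_).differentiableWithinAt
  · refine DifferentiableOn.const_smul (DifferentiableOn.sub ?_ (hfR.mono hsub)) _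
    exact hfR.comp (differentiable_id.add_const _).differentiableOn
      (fun z hz => hball z hz (hmem n z))
  · rw [Metric.tendstoUniformlyOn_iff]
    intro ε hε
    have hev : ∀ᶠ n in Filter.atTop, 4 * M * (‖v‖ / r) ^ 2 * t n < ε := by
      have := htlim.const_mul (4 * M * (‖v‖ / r) ^ 2)
      rw [mul_zero] at this
      exact this.eventually_lt_const hε
    filter_upwards [hev] with n hn z hz
    have h1 := norm_sub_sub_fderiv_le (hfR.mono (hball z hz)) (fun w hw => hM w (hball z hz hw))
      (hmem n z)
    rw [add_sub_cancel_left, norm_smul, Complex.norm_real, Real.norm_of_nonneg (ht0 n).le,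
      map_smul] at h1
    have htn : (t n : ℂ) ≠ 0 := by exact_mod_cast (ht0 n).ne'
    have h2 : (t n : ℂ)⁻¹ • (f (z + (t n : ℂ) • v) - f z) - fderiv ℂ f z v
        = (t n : ℂ)⁻¹ • (f (z + (t n : ℂ) • v) - f z - (t n : ℂ) • fderiv ℂ f z v) := by
      rw [smul_sub _ _ ((t n : ℂ) • _), smul_smul, inv_mul_cancel₀ htn, one_smul]
    rw [dist_comm, dist_eq_norm, h2, norm_smul, norm_inv, Complex.norm_real,
      Real.norm_of_nonneg (ht0 n).le]
    refine lt_of_le_of_lt ?_ hn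
    calc (t n)⁻¹ * _ ≤ (t n)⁻¹ * (4 * M * (t n * ‖v‖ / r) ^ 2) := by
          have := (ht0 n).le
          gcongr
      _ = 4 * M * (‖v‖ / r) ^ 2 * t n := by
          have := (ht0 n).ne'
          field_simp

theorem hasStrictFDerivAt_of_differentiableOn [CompleteSpace F] [FiniteDimensional ℂ E]
    {f : E → F} {U : Set E} (hU : IsOpen U) (hf : DifferentiableOn ℂ f U) {a : E} (ha : a ∈ U) :
    HasStrictFDerivAt f (fderiv ℂ f a) a := by
  refine hasStrictFDerivAt_of_hasFDerivAt_of_continuousAt ?_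
    ((continuousOn_clm_apply.2 fun v => (hf.fderiv_apply_of_isOpen hU v).continuousOn).continuousAt
      (hU.mem_nhds ha))
  filter_upwards [hU.mem_nhds ha] with y hy
  exact (hf.differentiableAt (hU.mem_nhds hy)).hasFDerivAt

/-- **Cartan's linearization**: a holomorphic involution with an isolated fixed point has
differential `-1` there. -/
theorem fderiv_eq_neg_id_of_involution [CompleteSpace E] [FiniteDimensional ℂ E] {σ : E → E}
    {U : Set E} (hU : IsOpen U) (hσ : DifferentiableOn ℂ σ U) (hinv : ∀ z ∈ U, σ (σ z) = z)
    {a : E} (ha : a ∈ U) (hfix : σ a = a)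
    (hiso : ∃ ε > 0, ∀ y ∈ U, dist y a < ε → σ y = y → y = a) :
    fderiv ℂ σ a = -ContinuousLinearMap.id ℂ E := by
  obtain ⟨ε, hε, hiso⟩ := hiso
  set A := fderiv ℂ σ a with hA
  have hsA : HasStrictFDerivAt σ A a := hasStrictFDerivAt_of_differentiableOn hU hσ ha
  have hAA : A.comp A = ContinuousLinearMap.id ℂ E := by
    have h1 : HasFDerivAt (σ ∘ σ) (A.comp A) a :=
      HasFDerivAt.comp a (by rw [hfix]; exact hsA.hasFDerivAt) hsA.hasFDerivAt
    have h2 : HasFDerivAt (σ ∘ σ) (ContinuousLinearMap.id ℂ E) a :=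
      (hasFDerivAt_id a).congr_of_eventuallyEq
        (by filter_upwards [hU.mem_nhds ha] with z hz using hinv z hz)
    exact h1.unique h2
  have hAA' : ∀ v, A (A v) = v := fun v => congrArg (fun L : E →L[ℂ] E => L v) hAA
  set Φ : E → E := fun z => (2⁻¹ : ℂ) • ((z - a) + A (σ z - a)) with hΦ
  have hΦa : Φ a = 0 := by simp [hΦ, hfix]
  have hΦs : HasStrictFDerivAt Φ (ContinuousLinearEquiv.refl ℂ E : E →L[ℂ] E) a := by
    have h := (((hasStrictFDerivAt_id a).sub_const a).add
      (A.hasStrictFDerivAt.comp a (hsA.sub_const a))).const_smul (2⁻¹ : ℂ)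
    refine h.congr_fderiv ?_
    ext v
    simp only [_root_.smul_apply, _root_.add_apply,
      ContinuousLinearMap.comp_apply, ContinuousLinearMap.id_apply, hAA',
      ContinuousLinearEquiv.coe_refl]
    rw [← two_smul ℂ v, smul_smul]
    norm_num
  have hΦσ : ∀ z ∈ U, Φ (σ z) = A (Φ z) := fun z hz => by
    simp only [hΦ, hinv z hz, map_smul, map_add, hAA']
    rw [add_comm]
  set e := hΦs.toOpenPartialHomeomorph Φ with he
  have hea : a ∈ e.source := hΦs.mem_toOpenPartialHomeomorph_source
  have hcoe : (e : E → E) = Φ := hΦs.toOpenPartialHomeomorph_coe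
  have hinj : InjOn Φ e.source := hcoe ▸ e.injOn
  have hσc : ContinuousAt σ a := hsA.hasFDerivAt.continuousAt
  have hnear : ∀ᶠ z in nhds a, z ∈ U ∧ dist z a < ε ∧ z ∈ e.source ∧ σ z ∈ e.source := by
    refine (hU.eventually_mem ha).and (Filter.Eventually.and (Metric.ball_mem_nhds a hε)
      ((e.open_source.eventually_mem hea).and (hσc.eventually_mem ?_)))
    rw [hfix]
    exact e.open_source.mem_nhds hea
  have hno : ∀ v, A v = v → v = 0 := by
    intro v hv
    have hmap := hΦs.map_nhds_eq_of_equiv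
    rw [hΦa] at hmap
    have himg : Φ '' {z | z ∈ U ∧ dist z a < ε ∧ z ∈ e.source ∧ σ z ∈ e.source} ∈ nhds (0 : E) := by
      rw [← hmap]; exact Filter.image_mem_map hnear
    have ht : Filter.Tendsto (fun t : ℝ => (t : ℂ) • v) (nhdsWithin 0 {0}ᶜ) (nhds 0) := by
      have : Continuous fun t : ℝ => (t : ℂ) • v := by fun_prop
      simpa using (this.tendsto 0).mono_left nhdsWithin_le_nhds
    obtain ⟨t, ⟨z, ⟨hzU, hzε, hze, hσe⟩, hz⟩, ht0⟩ :=
      ((ht.eventually_mem himg).and self_mem_nhdsWithin).exists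
    have h1 : σ z = z := hinj hσe hze (by rw [hΦσ z hzU, hz, map_smul, hv])
    have h2 := hiso z hzU hzε h1
    rw [h2, hΦa] at hz
    have : (t : ℂ) ≠ 0 := by exact_mod_cast ht0
    exact (smul_eq_zero.1 hz.symm).resolve_left this
  ext w
  have := hno (A w + w) (by rw [map_add, hAA', add_comm])
  simpa using eq_neg_of_add_eq_zero_left this

end HolomorphicMaps

section MeanValue

open MeasureTheory

theorem measurePreserving_circle_smul {ι : Type*} [Fintype ι] {c : ℂ} (hc : ‖c‖ = 1) :
    MeasurePreserving (fun w : ι → ℂ => c • w) := by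
  have h : MeasurePreserving (fun w : ℂ => c * w) := by
    have := (rotation ⟨c, mem_sphere_zero_iff_norm.2 hc⟩).measurePreserving
    exact this
  exact volume_preserving_pi (fun _ : ι => h)

theorem setIntegral_closedBall_circle_smul {ι : Type*} [Fintype ι] {c : ℂ} (hc : ‖c‖ = 1) (r : ℝ)
    (g : (ι → ℂ) → ℂ) :
    ∫ w in Metric.closedBall 0 r, g (c • w) = ∫ w in Metric.closedBall 0 r, g w := by
  have hc0 : c ≠ 0 := by rintro rfl; simp at hc
  have hpre : (fun w : ι → ℂ => c • w) ⁻¹' Metric.closedBall 0 r = Metric.closedBall 0 r := by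
    ext w; simp [norm_smul, hc]
  have h := (measurePreserving_circle_smul (ι := ι) hc).setIntegral_preimage_emb
    (Homeomorph.smulOfNeZero c hc0).measurableEmbedding g (Metric.closedBall 0 r)
  rwa [hpre] at h

theorem intervalIntegral_circle_eq {E : Type*} [NormedAddCommGroup E] [NormedSpace ℂ E]
    {f : E → ℂ} {U : Set E} (hf : DifferentiableOn ℂ f U) {z w : E}
    (hw : ∀ ζ : ℂ, ‖ζ‖ ≤ 1 → z + ζ • w ∈ U) :
    ∫ θ in (0 : ℝ)..(2 * Real.pi), f (z + circleMap 0 1 θ • w) = (2 * Real.pi) * f z := by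
  have hd : DifferentiableOn ℂ (fun ζ : ℂ => f (z + ζ • w)) (Metric.closedBall 0 1) :=
    hf.comp (by fun_prop) (fun ζ hζ => hw ζ (by simpa using hζ))
  have h := DiffContOnCl.circleAverage (f := fun ζ : ℂ => f (z + ζ • w)) (R := 1) (c := 0)
    (by
      rw [abs_one]
      refine DifferentiableOn.diffContOnCl ?_
      rwa [closure_ball _ one_ne_zero])
  rw [Real.circleAverage] at h
  simp only [zero_smul, add_zero] at h
  rw [← h, Complex.real_smul]
  have : (Real.pi : ℂ) ≠ 0 := by exact_mod_cast Real.pi_ne_zero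
  push_cast
  field_simp

/-- The mean value property of holomorphic functions on polydiscs. -/
theorem setIntegral_closedBall_eq_of_differentiableOn {ι : Type*} [Fintype ι]
    {f : (ι → ℂ) → ℂ} {U : Set (ι → ℂ)} (hf : DifferentiableOn ℂ f U) {z : ι → ℂ} {r : ℝ}
    (hr : Metric.closedBall z r ⊆ U) :
    ∫ w in Metric.closedBall z r, f w = (volume.real (Metric.closedBall z r) : ℂ) * f z := by
  set B : Set (ι → ℂ) := Metric.closedBall 0 r with hB
  have htrans : ∀ g : (ι → ℂ) → ℂ, ∫ w in Metric.closedBall z r, g w = ∫ w in B, g (z + w) := by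
    intro g
    have h := (measurePreserving_add_left volume z).setIntegral_preimage_emb
      (measurableEmbedding_addLeft z) g (Metric.closedBall z r)
    rw [← h, hB]
    congr 2
    ext w; simp
  have hmem : ∀ w ∈ B, ∀ ζ : ℂ, ‖ζ‖ ≤ 1 → z + ζ • w ∈ Metric.closedBall z r := by
    intro w hw ζ hζ
    rw [hB, mem_closedBall_zero_iff] at hw
    rw [Metric.mem_closedBall, dist_eq_norm, add_sub_cancel_left, norm_smul]
    calc ‖ζ‖ * ‖w‖ ≤ 1 * ‖w‖ := by gcongr
      _ ≤ r := by simpa using hw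
  have hint : Integrable (Function.uncurry fun (θ : ℝ) (w : ι → ℂ) => f (z + circleMap 0 1 θ • w))
      ((volume.restrict (Set.uIoc 0 (2 * Real.pi))).prod (volume.restrict B)) := by
    rw [Measure.prod_restrict]
    have hc : ContinuousOn
        (Function.uncurry fun (θ : ℝ) (w : ι → ℂ) => f (z + circleMap 0 1 θ • w))
        (Set.Icc 0 (2 * Real.pi) ×ˢ B) := by
      refine hf.continuousOn.comp (t := U) ?_ ?_
      · have : Continuous (circleMap 0 1) := continuous_circleMap 0 1
        fun_prop
      · rintro ⟨θ, w⟩ ⟨-, hw⟩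
        exact hr (hmem w hw _ (by simp))
    refine (hc.integrableOn_compact (μ := volume.prod volume)
      (isCompact_Icc.prod (isCompact_closedBall _ _))).mono_set (Set.prod_mono ?_ subset_rfl)
    rw [Set.uIoc_of_le (by positivity)]
    exact Set.Ioc_subset_Icc_self
  have h1 := intervalIntegral_integral_swap (f := fun (θ : ℝ) (w : ι → ℂ) =>
    f (z + circleMap 0 1 θ • w)) (μ := volume.restrict B) (a := 0) (b := 2 * Real.pi) hint
  have h2 : ∀ θ : ℝ, ∫ w in B, f (z + circleMap 0 1 θ • w) = ∫ w in B, f (z + w) := fun θ =>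
    setIntegral_closedBall_circle_smul (by simp) r (fun w => f (z + w))
  have h3 : ∫ w in B, (∫ θ in (0 : ℝ)..(2 * Real.pi), f (z + circleMap 0 1 θ • w))
      = ∫ w in B, (2 * Real.pi : ℂ) * f z :=
    setIntegral_congr_fun measurableSet_closedBall
      (fun w hw => intervalIntegral_circle_eq hf (fun ζ hζ => hr (hmem w hw ζ hζ)))
  simp only [h2, h3, intervalIntegral.integral_const, setIntegral_const, sub_zero,
    Complex.real_smul] at h1
  have hvol : volume.real (Metric.closedBall z r) = volume.real B := by
    rw [hB, Measure.real, Measure.real, Measure.addHaar_closedBall_center]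
  rw [htrans, hvol]
  have hpi : (2 * Real.pi : ℂ) ≠ 0 := by
    exact mul_ne_zero two_ne_zero (by exact_mod_cast Real.pi_ne_zero)
  apply mul_left_cancel₀ hpi
  push_cast at h1
  rw [h1]; ring

end MeanValue

section BergmanKernel

open MeasureTheory

theorem Submodule.norm_le_of_mem_topologicalClosure {H : Type*} [NormedAddCommGroup H]
    [InnerProductSpace ℂ H] {S : Submodule ℂ H} {u : H} (hu : u ∈ S.topologicalClosure) {M : ℝ}
    (hM : 0 ≤ M) (h : ∀ s ∈ S, ‖inner ℂ u s‖ ≤ M * ‖s‖) : ‖u‖ ≤ M := by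
  have hcl : IsClosed {s : H | ‖inner ℂ u s‖ ≤ M * ‖s‖} :=
    isClosed_le (by fun_prop) (by fun_prop)
  have huu : ‖inner ℂ u u‖ ≤ M * ‖u‖ := closure_minimal (fun s hs => h s hs) hcl hu
  rw [inner_self_eq_norm_sq_to_K] at huu
  rcases (norm_nonneg u).eq_or_lt with h0 | h0
  · rwa [← h0]
  · have : ‖u‖ * ‖u‖ ≤ M * ‖u‖ := by
      simpa [sq] using huu
    exact le_of_mul_le_mul_right this h0

variable {ι : Type*} [Fintype ι]

/-- Square integrable holomorphic functions on `D`, as a subspace of `L²(D)`. -/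
def bergmanSpace (D : Set (ι → ℂ)) : Submodule ℂ (Lp ℂ 2 (volume.restrict D)) where
  carrier := {u | ∃ f : (ι → ℂ) → ℂ, DifferentiableOn ℂ f D ∧ u =ᵐ[volume.restrict D] f}
  add_mem' := by
    rintro u v ⟨f, hf, huf⟩ ⟨g, hg, hvg⟩
    exact ⟨f + g, hf.add hg, (Lp.coeFn_add u v).trans (huf.add hvg)⟩
  zero_mem' := ⟨0, differentiableOn_const 0, Lp.coeFn_zero _ _ _⟩
  smul_mem' := by
    rintro c u ⟨f, hf, huf⟩
    exact ⟨c • f, hf.const_smul c, (Lp.coeFn_smul c u).trans (huf.const_smul c)⟩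

theorem exists_of_mem_bergmanSpace {D : Set (ι → ℂ)} {u : Lp ℂ 2 (volume.restrict D)}
    (hu : u ∈ bergmanSpace D) : ∃ f : (ι → ℂ) → ℂ, ∃ hf : MemLp f 2 (volume.restrict D),
      DifferentiableOn ℂ f D ∧ u = hf.toLp f := by
  obtain ⟨f, hf, huf⟩ := hu
  refine ⟨f, (memLp_congr_ae huf).1 (Lp.memLp u), hf, ?_⟩
  exact (Lp.toLp_coeFn u (Lp.memLp u)).symm.trans ((MemLp.toLp_eq_toLp_iff _ _).2 huf)

/-- `k z` is the Riesz representative in the closure of the Bergman space of evaluation at `z`. -/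
structure IsBergmanKernel (D : Set (ι → ℂ)) (k : (ι → ℂ) → Lp ℂ 2 (volume.restrict D)) : Prop where
  mem_closure : ∀ z ∈ D, k z ∈ (bergmanSpace D).topologicalClosure
  inner_toLp : ∀ z ∈ D, ∀ (f : (ι → ℂ) → ℂ) (hf : MemLp f 2 (volume.restrict D)),
    DifferentiableOn ℂ f D → inner ℂ (k z) (hf.toLp f) = f z

theorem inner_indicatorConstLp_closedBall {D : Set (ι → ℂ)}
    {z : ι → ℂ} {r : ℝ} (hr : Metric.closedBall z r ⊆ D)
    (hμ : volume.restrict D (Metric.closedBall z r) ≠ ⊤) {f : (ι → ℂ) → ℂ}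
    (hf : MemLp f 2 (volume.restrict D)) (hd : DifferentiableOn ℂ f D) :
    inner ℂ (indicatorConstLp 2 measurableSet_closedBall hμ (1 : ℂ)) (hf.toLp f)
      = (volume.real (Metric.closedBall z r) : ℂ) * f z := by
  rw [L2.inner_indicatorConstLp_one, setIntegral_congr_ae₀ measurableSet_closedBall.nullMeasurableSet
    (hf.coeFn_toLp.mono fun x hx _ => hx), Measure.restrict_restrict measurableSet_closedBall,
    inter_eq_left.2 hr, setIntegral_closedBall_eq_of_differentiableOn hd hr]

theorem restrict_closedBall_ne_top (D : Set (ι → ℂ)) (z : ι → ℂ) (r : ℝ) :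
    volume.restrict D (Metric.closedBall z r) ≠ ⊤ :=
  ((Measure.restrict_apply_le _ _).trans_lt measure_closedBall_lt_top).ne

theorem volume_real_closedBall_pos (z : ι → ℂ) {r : ℝ} (hr : 0 < r) :
    0 < volume.real (Metric.closedBall z r) :=
  ENNReal.toReal_pos (Metric.measure_closedBall_pos _ _ hr).ne' measure_closedBall_lt_top.ne

theorem exists_isBergmanKernel {D : Set (ι → ℂ)} (hD : IsOpen D) :
    ∃ k, IsBergmanKernel D k := by
  have hball : ∀ z ∈ D, ∃ r > 0, Metric.closedBall z r ⊆ D := fun z hz =>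
    Metric.nhds_basis_closedBall.mem_iff.1 (hD.mem_nhds hz)
  choose! r hr0 hr using hball
  refine ⟨fun z => (bergmanSpace D).topologicalClosure.starProjection
    ((volume.real (Metric.closedBall z (r z)) : ℂ)⁻¹ •
      indicatorConstLp 2 measurableSet_closedBall (restrict_closedBall_ne_top D z (r z)) (1 : ℂ)),
    fun z hz => Submodule.starProjection_apply_mem _ _, fun z hz f hf hd => ?_⟩
  have hmem : hf.toLp f ∈ (bergmanSpace D).topologicalClosure :=
    Submodule.le_topologicalClosure _ ⟨f, hd, hf.coeFn_toLp⟩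
  have hvol : (volume.real (Metric.closedBall z (r z)) : ℂ) ≠ 0 := by
    exact_mod_cast (volume_real_closedBall_pos z (hr0 z hz)).ne'
  rw [Submodule.inner_starProjection_left_eq_right, Submodule.starProjection_eq_self_iff.2 hmem,
    inner_smul_left, inner_indicatorConstLp_closedBall (hr z hz) _ hf hd, map_inv₀,
    Complex.conj_ofReal, inv_mul_cancel_left₀ hvol]

namespace IsBergmanKernel

variable {D : Set (ι → ℂ)} {k : (ι → ℂ) → Lp ℂ 2 (volume.restrict D)}

theorem norm_le (hk : IsBergmanKernel D k) {z : ι → ℂ} (hz : z ∈ D) {M : ℝ} (hM : 0 ≤ M)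
    (h : ∀ (f : (ι → ℂ) → ℂ) (hf : MemLp f 2 (volume.restrict D)), DifferentiableOn ℂ f D →
      ‖f z‖ ≤ M * ‖hf.toLp f‖) : ‖k z‖ ≤ M := by
  refine Submodule.norm_le_of_mem_topologicalClosure (hk.mem_closure z hz) hM fun s hs => ?_
  obtain ⟨f, hf, hd, rfl⟩ := exists_of_mem_bergmanSpace hs
  rw [hk.inner_toLp z hz f hf hd]
  exact h f hf hd

theorem norm_sub_le (hk : IsBergmanKernel D k) {z w : ι → ℂ} (hz : z ∈ D) (hw : w ∈ D) {M : ℝ}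
    (hM : 0 ≤ M) (h : ∀ (f : (ι → ℂ) → ℂ) (hf : MemLp f 2 (volume.restrict D)),
      DifferentiableOn ℂ f D → ‖f z - f w‖ ≤ M * ‖hf.toLp f‖) : ‖k z - k w‖ ≤ M := by
  refine Submodule.norm_le_of_mem_topologicalClosure
    (sub_mem (hk.mem_closure z hz) (hk.mem_closure w hw)) hM fun s hs => ?_
  obtain ⟨f, hf, hd, rfl⟩ := exists_of_mem_bergmanSpace hs
  rw [inner_sub_left, hk.inner_toLp z hz f hf hd, hk.inner_toLp w hw f hf hd]
  exact h f hf hd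

theorem norm_apply_le (hk : IsBergmanKernel D k) {z : ι → ℂ} (hz : z ∈ D) {f : (ι → ℂ) → ℂ}
    (hf : MemLp f 2 (volume.restrict D)) (hd : DifferentiableOn ℂ f D) :
    ‖f z‖ ≤ ‖k z‖ * ‖hf.toLp f‖ := by
  rw [← hk.inner_toLp z hz f hf hd]
  exact norm_inner_le_norm _ _

theorem exists_local_bound (hk : IsBergmanKernel D k) (hD : IsOpen D) {a : ι → ℂ} (ha : a ∈ D) :
    ∃ r > 0, ∃ C, 0 ≤ C ∧ Metric.ball a r ⊆ D ∧ ∀ z ∈ Metric.ball a r, ‖k z‖ ≤ C := by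
  obtain ⟨R, hR, hRD⟩ := Metric.nhds_basis_closedBall.mem_iff.1 (hD.mem_nhds ha)
  have hr : 0 < R / 2 := half_pos hR
  set V := volume.real (Metric.closedBall (0 : ι → ℂ) (R / 2)) with hV
  have hV0 : 0 < V := volume_real_closedBall_pos 0 hr
  refine ⟨R / 2, hr, V⁻¹ * V ^ (1 / (2 : ENNReal).toReal), by positivity,
    (Metric.ball_subset_closedBall.trans (Metric.closedBall_subset_closedBall (by linarith))).trans
      hRD, fun z hz => ?_⟩
  have hzD : Metric.closedBall z (R / 2) ⊆ D :=
    (Metric.closedBall_subset_closedBall' (by rw [Metric.mem_ball] at hz; linarith)).trans hRD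
  have hVz : volume.real (Metric.closedBall z (R / 2)) = V := by
    rw [hV, Measure.real, Measure.real, Measure.addHaar_closedBall_center]
  refine hk.norm_le (hzD (Metric.mem_closedBall_self hr.le)) (by positivity) fun f hf hd => ?_
  have h := inner_indicatorConstLp_closedBall hzD (restrict_closedBall_ne_top D z (R / 2)) hf hd
  have h2 := norm_inner_le_norm (𝕜 := ℂ) (indicatorConstLp 2 measurableSet_closedBall
    (restrict_closedBall_ne_top D z (R / 2)) (1 : ℂ)) (hf.toLp f)
  rw [h, norm_indicatorConstLp two_ne_zero ENNReal.ofNat_ne_top, hVz, norm_mul, Complex.norm_real,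
    Real.norm_of_nonneg hV0.le, norm_one, one_mul, measureReal_restrict_apply
      measurableSet_closedBall, inter_eq_left.2 hzD, hVz] at h2
  rw [mul_assoc, ← div_eq_inv_mul, le_div_iff₀' hV0]
  exact h2

theorem exists_local_lipschitz (hk : IsBergmanKernel D k) (hD : IsOpen D) {a : ι → ℂ}
    (ha : a ∈ D) : ∃ r > 0, ∃ L, Metric.ball a r ⊆ D ∧
      ∀ z ∈ Metric.ball a r, ∀ w ∈ Metric.ball a r, ‖k z - k w‖ ≤ L * ‖z - w‖ := by
  obtain ⟨R, hR, C, hC, hRD, hb⟩ := hk.exists_local_bound hD ha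
  have hsub : Metric.ball a (R / 3) ⊆ Metric.ball a R := Metric.ball_subset_ball (by linarith)
  refine ⟨R / 3, by positivity, 2 * C / (2 * R / 3), hsub.trans hRD, fun z hz w hw => ?_⟩
  have hsw : Metric.ball w (2 * R / 3) ⊆ Metric.ball a R :=
    Metric.ball_subset_ball' (by rw [Metric.mem_ball] at hw; linarith)
  have hzw : z ∈ Metric.ball w (2 * R / 3) := by
    rw [Metric.mem_ball] at *
    linarith [dist_triangle_right z w a]
  refine hk.norm_sub_le (hRD (hsub hz)) (hRD (hsub hw)) (by positivity) fun f hf hd => ?_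
  refine (norm_sub_le_of_differentiableOn_ball (hd.mono (hsw.trans hRD))
    (M := C * ‖hf.toLp f‖) (fun x hx => ?_) hzw).trans (le_of_eq (by ring))
  exact (hk.norm_apply_le (hRD (hsw hx)) hf hd).trans (by gcongr; exact hb x (hsw hx))

end IsBergmanKernel

end BergmanKernel

section JacobianDeterminant

open MeasureTheory

variable {m : ℕ}

/-- The holomorphic Jacobian determinant. -/
def jacDet (σ : (Fin m → ℂ) → (Fin m → ℂ)) (z : Fin m → ℂ) : ℂ := (Matrix.of (Jac σ z)).det

theorem jac_eq_fderiv {σ : (Fin m → ℂ) → (Fin m → ℂ)} {z : Fin m → ℂ}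
    (h : DifferentiableAt ℂ σ z) (i l : Fin m) : Jac σ z i l = fderiv ℂ σ z (Pi.single l 1) i := by
  rw [Jac, fderiv_apply h]
  rfl

theorem jacDet_eq_det_fderiv {σ : (Fin m → ℂ) → (Fin m → ℂ)} {z : Fin m → ℂ}
    (h : DifferentiableAt ℂ σ z) :
    jacDet σ z = LinearMap.det (fderiv ℂ σ z : (Fin m → ℂ) →ₗ[ℂ] (Fin m → ℂ)) := by
  rw [jacDet, ← LinearMap.det_toMatrix']
  congr 1
  ext i l
  simp only [Matrix.of_apply, jac_eq_fderiv h, LinearMap.toMatrix'_apply]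
  rfl

theorem differentiableOn_jacDet {σ : (Fin m → ℂ) → (Fin m → ℂ)} {D : Set (Fin m → ℂ)}
    (hD : IsOpen D) (hσ : DifferentiableOn ℂ σ D) : DifferentiableOn ℂ (jacDet σ) D := by
  have hJ : ∀ i l, DifferentiableOn ℂ (fun z => Jac σ z i l) D := fun i l =>
    DifferentiableOn.fderiv_apply_of_isOpen hD (differentiableOn_pi.1 hσ i) _
  have : jacDet σ = fun z => (Matrix.of (Jac σ z)).det := rfl
  simp only [this, Matrix.det_apply', Matrix.of_apply]
  exact DifferentiableOn.fun_sum fun p _ => (differentiableOn_const _).mul fun z hz =>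
    (HasFDerivWithinAt.finsetProd fun i _ =>
      (hJ (p i) i z hz).hasFDerivWithinAt).differentiableWithinAt

theorem abs_det_restrictScalars_fderiv {σ : (Fin m → ℂ) → (Fin m → ℂ)} {z : Fin m → ℂ}
    (h : DifferentiableAt ℂ σ z) :
    |((fderiv ℂ σ z).restrictScalars ℝ).det| = ‖jacDet σ z‖ ^ 2 := by
  have h1 : ((fderiv ℂ σ z).restrictScalars ℝ).det = Algebra.norm ℝ (jacDet σ z) := by
    rw [jacDet_eq_det_fderiv h, ← LinearMap.det_restrictScalars]
    rfl
  rw [h1, Algebra.norm_complex_apply, Complex.normSq_eq_norm_sq, abs_of_nonneg (by positivity)]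

/-- `σ` is a holomorphic involution of `D`. -/
structure IsHolInvolution (D : Set (Fin m → ℂ)) (σ : (Fin m → ℂ) → (Fin m → ℂ)) : Prop where
  differentiableOn : DifferentiableOn ℂ σ D
  mapsTo : MapsTo σ D D
  involutive : ∀ z ∈ D, σ (σ z) = z

namespace IsHolInvolution

variable {D : Set (Fin m → ℂ)} {σ : (Fin m → ℂ) → (Fin m → ℂ)}

theorem jacDet_mul_jacDet (h : IsHolInvolution D σ) (hD : IsOpen D) {z : Fin m → ℂ} (hz : z ∈ D) :
    jacDet σ (σ z) * jacDet σ z = 1 := by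
  have hdz := h.differentiableOn.differentiableAt (hD.mem_nhds hz)
  have hdσ := h.differentiableOn.differentiableAt (hD.mem_nhds (h.mapsTo hz))
  have h1 : HasFDerivAt (σ ∘ σ) ((fderiv ℂ σ (σ z)).comp (fderiv ℂ σ z)) z :=
    hdσ.hasFDerivAt.comp z hdz.hasFDerivAt
  have h2 : HasFDerivAt (σ ∘ σ) (ContinuousLinearMap.id ℂ (Fin m → ℂ)) z :=
    (hasFDerivAt_id z).congr_of_eventuallyEq
      (by filter_upwards [hD.mem_nhds hz] with w hw using h.involutive w hw)
  rw [jacDet_eq_det_fderiv hdz, jacDet_eq_det_fderiv hdσ, ← LinearMap.det_comp,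
    ← ContinuousLinearMap.toLinearMap_comp, h1.unique h2]
  exact LinearMap.det_id

theorem image_eq (h : IsHolInvolution D σ) : σ '' D = D :=
  (image_subset_iff.2 h.mapsTo).antisymm fun z hz => ⟨σ z, h.mapsTo hz, h.involutive z hz⟩

theorem injOn (h : IsHolInvolution D σ) : InjOn σ D := fun z hz w hw hzw => by
  rw [← h.involutive z hz, hzw, h.involutive w hw]

theorem eLpNorm_jacDet_mul_comp (h : IsHolInvolution D σ) (hD : IsOpen D) (f : (Fin m → ℂ) → ℂ) :
    eLpNorm (fun z => jacDet σ z * f (σ z)) 2 (volume.restrict D)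
      = eLpNorm f 2 (volume.restrict D) := by
  have hd : ∀ z ∈ D, DifferentiableAt ℂ σ z := fun z hz =>
    h.differentiableOn.differentiableAt (hD.mem_nhds hz)
  have key := lintegral_image_eq_lintegral_abs_det_fderiv_mul volume hD.measurableSet
    (fun z hz => ((hd z hz).hasFDerivAt.restrictScalars ℝ).hasFDerivWithinAt) h.injOn
    (fun z => ‖f z‖ₑ ^ 2)
  rw [h.image_eq] at key
  have h2 : ∀ g : (Fin m → ℂ) → ℂ, eLpNorm g 2 (volume.restrict D)
      = (∫⁻ z in D, ‖g z‖ₑ ^ 2) ^ (1 / (2 : ℝ)) := fun g => by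
    rw [eLpNorm_eq_lintegral_rpow_enorm_toReal two_ne_zero ENNReal.ofNat_ne_top]
    simp
  rw [h2, h2, key]
  congr 1
  refine setLIntegral_congr_fun hD.measurableSet fun z hz => ?_

  rw [abs_det_restrictScalars_fderiv (hd z hz), enorm_mul, mul_pow, ENNReal.ofReal_pow
    (norm_nonneg _), ofReal_norm]

theorem norm_jacDet_mul_le (h : IsHolInvolution D σ) (hD : IsOpen D)
    {k : (Fin m → ℂ) → Lp ℂ 2 (volume.restrict D)} (hk : IsBergmanKernel D k) {z : Fin m → ℂ}
    (hz : z ∈ D) : ‖jacDet σ z‖ * ‖k (σ z)‖ ≤ ‖k z‖ := by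
  have hJ : 0 < ‖jacDet σ z‖ := norm_pos_iff.2 (right_ne_zero_of_mul_eq_one
    (h.jacDet_mul_jacDet hD hz))
  rw [← le_div_iff₀' hJ]
  refine hk.norm_le (h.mapsTo hz) (by positivity) fun f hf hd => ?_
  have hd' : DifferentiableOn ℂ (fun z => jacDet σ z * f (σ z)) D :=
    (differentiableOn_jacDet hD h.differentiableOn).mul (hd.comp h.differentiableOn h.mapsTo)
  have hf' : MemLp (fun z => jacDet σ z * f (σ z)) 2 (volume.restrict D) :=
    ⟨hd'.continuousOn.aestronglyMeasurable hD.measurableSet, by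
      rw [h.eLpNorm_jacDet_mul_comp hD]; exact hf.2⟩
  have h1 := hk.norm_apply_le hz hf' hd'
  rw [Lp.norm_toLp, h.eLpNorm_jacDet_mul_comp hD, ← Lp.norm_toLp f hf, norm_mul] at h1
  rw [div_mul_eq_mul_div, le_div_iff₀' hJ]
  exact h1

theorem norm_sq_kernel_eq (h : IsHolInvolution D σ) (hD : IsOpen D)
    {k : (Fin m → ℂ) → Lp ℂ 2 (volume.restrict D)} (hk : IsBergmanKernel D k) {z : Fin m → ℂ}
    (hz : z ∈ D) : ‖k z‖ ^ 2 = ‖jacDet σ z‖ ^ 2 * ‖k (σ z)‖ ^ 2 := by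
  have h1 := h.norm_jacDet_mul_le hD hk hz
  have h2 := h.norm_jacDet_mul_le hD hk (h.mapsTo hz)
  rw [h.involutive z hz] at h2
  have h3 : ‖jacDet σ (σ z)‖ * ‖jacDet σ z‖ = 1 := by
    rw [← norm_mul, h.jacDet_mul_jacDet hD hz, norm_one]
  have h4 : ‖k z‖ ≤ ‖jacDet σ z‖ * ‖k (σ z)‖ :=
    calc ‖k z‖ = ‖jacDet σ z‖ * (‖jacDet σ (σ z)‖ * ‖k z‖) := by
          rw [← mul_assoc, mul_comm ‖jacDet σ z‖, h3, one_mul]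
      _ ≤ _ := by gcongr
  rw [le_antisymm h4 h1, mul_pow]

theorem det_metric_eq (h : IsHolInvolution D σ) {G : HermMetricOn D}
    (hG : IsCanonicalKahlerMetric D G) {z : Fin m → ℂ} (hz : z ∈ D) :
    (G.g z).det = ((‖jacDet σ z‖ ^ 2 : ℝ) : ℂ) * (G.g (σ z)).det := by
  have h1 := hG.2 σ h.differentiableOn h.mapsTo
    ⟨σ, h.differentiableOn, h.mapsTo, h.involutive, h.involutive⟩ z hz
  have h2 : pullbackMetric G.g σ z
      = (Matrix.of (Jac σ z)).transpose * G.g (σ z) * (Matrix.of (Jac σ z)).map (starRingEnd ℂ) := by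
    ext l k
    simp only [pullbackMetric, Matrix.of_apply, Matrix.mul_apply, Matrix.transpose_apply,
      Matrix.map_apply, Finset.sum_mul]
    rw [Finset.sum_comm]
    exact Finset.sum_congr rfl fun j _ => Finset.sum_congr rfl fun i _ => by ring
  have h3 : ((Matrix.of (Jac σ z)).map (starRingEnd ℂ)).det = (starRingEnd ℂ) (jacDet σ z) :=
    ((starRingEnd ℂ).map_det _).symm
  rw [← h1, h2, Matrix.det_mul, Matrix.det_mul, Matrix.det_transpose, h3]
  have h4 : jacDet σ z * (starRingEnd ℂ) (jacDet σ z) = ((‖jacDet σ z‖ ^ 2 : ℝ) : ℂ) := by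
    rw [Complex.mul_conj, Complex.normSq_eq_norm_sq]
  rw [← h4, jacDet]
  ring

end IsHolInvolution

end JacobianDeterminant

section SymmetricDerivative

theorem le_of_symmetric_increment_pos {g : ℝ → ℝ} (hc : ContinuousOn g (Set.Icc 0 1))
    (h : ∀ t ∈ Set.Ioo (0 : ℝ) 1, ∀ᶠ s in nhdsWithin 0 (Set.Ioi 0), g (t - s) < g (t + s)) :
    g 0 ≤ g 1 := by
  by_contra! hlt
  obtain ⟨c, hc1, hc0⟩ := exists_between hlt
  set S : Set ℝ := {x | x ∈ Set.Icc 0 1 ∧ c < g x} with hS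
  have h0S : (0 : ℝ) ∈ S := ⟨by simp, hc0⟩
  have hbdd : BddAbove S := ⟨1, fun x hx => hx.1.2⟩
  set x₀ := sSup S with hx₀
  have hx0 : 0 ≤ x₀ := le_csSup hbdd h0S
  have hx1 : x₀ ≤ 1 := csSup_le ⟨0, h0S⟩ fun x hx => hx.1.2
  have hxI : x₀ ∈ Set.Icc (0 : ℝ) 1 := ⟨hx0, hx1⟩
  have hgx : c ≤ g x₀ := by
    by_contra! hgc
    have h1 : ∀ᶠ x in nhdsWithin x₀ (Set.Icc 0 1), g x < c := (hc x₀ hxI).eventually_lt_const hgc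
    obtain ⟨δ, hδ, hδ'⟩ := Metric.mem_nhdsWithin_iff.1 h1
    obtain ⟨x, hxS, hx⟩ := exists_lt_of_lt_csSup ⟨0, h0S⟩ (sub_lt_self x₀ hδ)
    have hle : x ≤ x₀ := le_csSup hbdd hxS
    have h2 : g x < c := hδ' ⟨by rw [Metric.mem_ball, Real.dist_eq, abs_lt]; constructor <;> linarith,
      hxS.1⟩
    exact absurd hxS.2 h2.not_gt
  have hx1' : x₀ < 1 := lt_of_le_of_ne hx1 fun hx => by
    rw [hx] at hgx; linarith
  have hxS : x₀ ∉ S := fun hxS => by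
    have h1 : ∀ᶠ x in nhdsWithin x₀ (Set.Icc 0 1), c < g x :=
      (hc x₀ hxI).eventually_const_lt hxS.2
    obtain ⟨δ, hδ, hδ'⟩ := Metric.mem_nhdsWithin_iff.1 h1
    set y := min 1 (x₀ + δ / 2) with hy
    have hy1 : x₀ < y := lt_min hx1' (by linarith)
    have hy2 : y ≤ x₀ + δ / 2 := min_le_right _ _
    have hyI : y ∈ Set.Icc (0 : ℝ) 1 := ⟨hx0.trans hy1.le, min_le_left _ _⟩
    have hyS : y ∈ S := ⟨hyI, hδ' ⟨by
      rw [Metric.mem_ball, Real.dist_eq, abs_lt]; constructor <;> linarith, hyI⟩⟩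
    exact absurd (le_csSup hbdd hyS) hy1.not_ge
  have hx0' : 0 < x₀ := lt_of_le_of_ne hx0 fun hx => hxS (hx ▸ h0S)
  obtain ⟨δ, hδ, hδ'⟩ := mem_nhdsGT_iff_exists_Ioo_subset.1 (h x₀ ⟨hx0', hx1'⟩)
  have hδ0 : 0 < δ := hδ
  have hη : 0 < min δ (1 - x₀) := lt_min hδ0 (by linarith)
  obtain ⟨x, hx, hxlt⟩ := exists_lt_of_lt_csSup ⟨0, h0S⟩ (sub_lt_self x₀ hη)
  have hne : x < x₀ := lt_of_le_of_ne (le_csSup hbdd hx) fun h => hxS (h ▸ hx)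
  have hδle := min_le_left δ (1 - x₀)
  have h1le := min_le_right δ (1 - x₀)
  have h1 : g (x₀ - (x₀ - x)) < g (x₀ + (x₀ - x)) :=
    hδ' (show x₀ - x ∈ Set.Ioo 0 δ from ⟨by linarith, by linarith⟩)
  rw [sub_sub_cancel] at h1
  have h2 : x₀ + (x₀ - x) ∈ S := ⟨⟨by linarith, by linarith⟩, hx.2.trans h1⟩
  linarith [le_csSup hbdd h2]

theorem le_of_symmetric_deriv_eq_zero {g : ℝ → ℝ} (hc : ContinuousOn g (Set.Icc 0 1))
    (h : ∀ t ∈ Set.Ioo (0 : ℝ) 1, ∀ ε > 0, ∀ᶠ s in nhdsWithin 0 (Set.Ioi 0),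
      |g (t + s) - g (t - s)| ≤ ε * s) : g 0 ≤ g 1 := by
  refine le_of_forall_pos_le_add fun ε hε => ?_
  have := le_of_symmetric_increment_pos (g := fun t => g t + ε * t) (by fun_prop)
    (fun t ht => by
      filter_upwards [h t ht ε hε, self_mem_nhdsWithin] with s hs hs0
      have h1 := (abs_le.1 hs).1
      have h2 : 0 < ε * s := mul_pos hε hs0
      linarith)
  simpa using this

theorem eq_of_symmetric_deriv_eq_zero {g : ℝ → ℝ} (hc : ContinuousOn g (Set.Icc 0 1))
    (h : ∀ t ∈ Set.Ioo (0 : ℝ) 1, ∀ ε > 0, ∀ᶠ s in nhdsWithin 0 (Set.Ioi 0),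
      |g (t + s) - g (t - s)| ≤ ε * s) : g 0 = g 1 := by
  refine (le_of_symmetric_deriv_eq_zero hc h).antisymm (neg_le_neg_iff.1 ?_)
  refine le_of_symmetric_deriv_eq_zero (g := fun t => -g t) hc.neg fun t ht ε hε => ?_
  filter_upwards [h t ht ε hε] with s hs
  rwa [neg_sub_neg, abs_sub_comm]

theorem eq_of_symmetric_deriv_eq_zero_of_isPreconnected {E : Type*} [NormedAddCommGroup E]
    [NormedSpace ℝ E] {D : Set E} (hD : IsOpen D) (hD' : IsPreconnected D) {q : E → ℝ}
    (hq : ContinuousOn q D)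
    (h : ∀ a ∈ D, ∀ v : E, ∀ ε > 0, ∀ᶠ s : ℝ in nhdsWithin 0 (Set.Ioi 0),
      |q (a + s • v) - q (a - s • v)| ≤ ε * s) {x y : E} (hx : x ∈ D) (hy : y ∈ D) :
    q x = q y := by
  have hloc : ∀ a ∈ D, q =ᶠ[nhds a] fun _ => q a := by
    intro a ha
    obtain ⟨r, hr, hrD⟩ := Metric.isOpen_iff.1 hD a ha
    filter_upwards [Metric.ball_mem_nhds a hr] with b hb
    have hseg : ∀ t ∈ Set.Icc (0 : ℝ) 1, a + t • (b - a) ∈ D := fun t ht =>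
      hrD ((convex_ball a r).add_smul_sub_mem (Metric.mem_ball_self hr) hb ht)
    have := eq_of_symmetric_deriv_eq_zero (g := fun t : ℝ => q (a + t • (b - a)))
      (hq.comp (by fun_prop) hseg) (fun t ht ε hε => by
        filter_upwards [h _ (hseg t ⟨ht.1.le, ht.2.le⟩) (b - a) ε hε] with s hs
        simpa only [add_smul, sub_smul, add_assoc, add_sub_assoc] using hs)
    simpa using this.symm
  exact hD.is_const_of_fderiv_eq_zero (𝕜 := ℝ) hD'
    (fun a ha => ((hasFDerivAt_const (q a) a).congr_of_eventuallyEq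
      (hloc a ha)).differentiableAt.differentiableWithinAt)
    (fun a ha => ((hasFDerivAt_const (q a) a).congr_of_eventuallyEq (hloc a ha)).fderiv) hx hy

theorem exists_lipschitzOnWith_mul {E : Type*} [PseudoMetricSpace E] {f g : E → ℝ} {a : E}
    (hf : ∃ K, ∃ t ∈ nhds a, LipschitzOnWith K f t)
    (hg : ∃ K, ∃ t ∈ nhds a, LipschitzOnWith K g t) :
    ∃ K, ∃ t ∈ nhds a, LipschitzOnWith K (fun z => f z * g z) t := by
  obtain ⟨K, s, hs, hf⟩ := hf
  obtain ⟨L, t, ht, hg⟩ := hg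
  have hfa : ContinuousAt f a := hf.continuousOn.continuousAt hs
  have hga : ContinuousAt g a := hg.continuousOn.continuousAt ht
  have h1 : ∀ᶠ z in nhds a, |f z| < |f a| + 1 := hfa.abs.eventually_lt_const (by linarith)
  have h2 : ∀ᶠ z in nhds a, |g z| < |g a| + 1 := hga.abs.eventually_lt_const (by linarith)
  refine ⟨((|f a| + 1) * L + (|g a| + 1) * K).toNNReal, _,
    Filter.inter_mem (Filter.inter_mem hs ht) (h1.and h2), LipschitzOnWith.of_dist_le_mul ?_⟩
  rintro z ⟨⟨hzs, hzt⟩, hz1, hz2⟩ w ⟨⟨hws, hwt⟩, hw1, hw2⟩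
  have hK := hf.dist_le_mul z hzs w hws
  have hL := hg.dist_le_mul z hzt w hwt
  rw [Real.coe_toNNReal _ (by positivity)]
  rw [Real.dist_eq] at *
  calc |f z * g z - f w * g w| = |f z * (g z - g w) + g w * (f z - f w)| := by ring_nf
    _ ≤ |f z| * |g z - g w| + |g w| * |f z - f w| := by
        rw [← abs_mul, ← abs_mul]; exact abs_add_le _ _
    _ ≤ (|f a| + 1) * (L * dist z w) + (|g a| + 1) * (K * dist z w) := by
        gcongr
    _ = _ := by ring

end SymmetricDerivative

section KernelProportional

open MeasureTheory

variable {m : ℕ} {D : Set (Fin m → ℂ)}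

theorem HermMetricOn.contDiffOn_det (G : HermMetricOn D) :
    ContDiffOn ℝ (⊤ : ℕ∞) (fun z => (G.g z).det) D := by
  simp only [Matrix.det_apply']
  exact ContDiffOn.sum fun p _ => contDiffOn_const.mul
    (contDiffOn_prod fun i _ => G.smooth (p i) i)

theorem HermMetricOn.det_eq_re (G : HermMetricOn D) {z : Fin m → ℂ} (hz : z ∈ D) :
    (G.g z).det = ((G.g z).det.re : ℂ) ∧ 0 < (G.g z).det.re := by
  have h := (Complex.lt_def.1 (G.posDef z hz).det_pos)
  exact ⟨Complex.ext rfl (by simpa using h.2.symm), by simpa using h.1⟩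

theorem IsBddSymmDomain.exists_isHolInvolution (hD : IsBddSymmDomain D) {a : Fin m → ℂ}
    (ha : a ∈ D) : ∃ σ, IsHolInvolution D σ ∧ σ a = a ∧
      HasFDerivAt σ (-ContinuousLinearMap.id ℂ (Fin m → ℂ)) a := by
  obtain ⟨σ, hσ, hmaps, hinv, hfix, hiso⟩ := hD.symm a ha
  refine ⟨σ, ⟨hσ, hmaps, hinv⟩, hfix, ?_⟩
  rw [← fderiv_eq_neg_id_of_involution hD.isOpen hσ hinv ha hfix hiso]
  exact (hσ.differentiableAt (hD.isOpen.mem_nhds ha)).hasFDerivAt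

/-- On a bounded symmetric domain the Bergman kernel is, on the diagonal, a constant multiple of
the volume density of any canonical metric. -/
theorem exists_norm_sq_kernel_eq (hD : IsBddSymmDomain D) {G : HermMetricOn D}
    (hG : IsCanonicalKahlerMetric D G) {k : (Fin m → ℂ) → Lp ℂ 2 (volume.restrict D)}
    (hk : IsBergmanKernel D k) :
    ∃ c : ℝ, ∀ z ∈ D, ((‖k z‖ ^ 2 : ℝ) : ℂ) = c * (G.g z).det := by
  set φ : (Fin m → ℂ) → ℝ := fun z => (G.g z).det.re with hφ
  set q : (Fin m → ℂ) → ℝ := fun z => ‖k z‖ * ‖k z‖ * (φ z)⁻¹ with hq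
  have hlip : ∀ a ∈ D, ∃ K, ∃ t ∈ nhds a, LipschitzOnWith K q t := by
    intro a ha
    have hk1 : ∃ K, ∃ t ∈ nhds a, LipschitzOnWith K (fun z => ‖k z‖) t := by
      obtain ⟨r, hr, L, -, hL⟩ := hk.exists_local_lipschitz hD.isOpen ha
      refine ⟨L.toNNReal, _, Metric.ball_mem_nhds a hr, LipschitzOnWith.of_dist_le_mul ?_⟩
      intro z hz w hw
      rw [Real.dist_eq, dist_eq_norm]
      calc |‖k z‖ - ‖k w‖| ≤ ‖k z - k w‖ := abs_norm_sub_norm_le _ _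
        _ ≤ L * ‖z - w‖ := hL z hz w hw
        _ ≤ _ := by gcongr; exact Real.le_coe_toNNReal L
    have hφ1 : ContDiffAt ℝ 1 (fun z => (φ z)⁻¹) a := by
      refine ContDiffAt.inv ?_ (G.det_eq_re ha).2.ne'
      have := (G.contDiffOn_det.contDiffAt (hD.isOpen.mem_nhds ha)).of_le
        (m := 1) (by exact_mod_cast le_top)
      exact Complex.reCLM.contDiff.contDiffAt.comp a this
    exact exists_lipschitzOnWith_mul (exists_lipschitzOnWith_mul hk1 hk1)
      hφ1.exists_lipschitzOnWith
  have hinv : ∀ σ, IsHolInvolution D σ → ∀ z ∈ D, q (σ z) = q z := by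
    intro σ hσ z hz
    have h1 := hσ.norm_sq_kernel_eq hD.isOpen hk hz
    have h2 : φ z = ‖jacDet σ z‖ ^ 2 * φ (σ z) := by
      simp only [hφ]
      rw [hσ.det_metric_eq hG hz, Complex.re_ofReal_mul]
    have hJ : ‖jacDet σ z‖ ≠ 0 :=
      norm_ne_zero_iff.2 (right_ne_zero_of_mul_eq_one (hσ.jacDet_mul_jacDet hD.isOpen hz))
    have h3 : φ (σ z) ≠ 0 := (G.det_eq_re (hσ.mapsTo hz)).2.ne'
    simp only [hq]
    rw [← sq, ← sq, h1, h2]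
    field_simp
  have hsym : ∀ a ∈ D, ∀ v : Fin m → ℂ, ∀ ε > 0, ∀ᶠ s : ℝ in nhdsWithin 0 (Set.Ioi 0),
      |q (a + s • v) - q (a - s • v)| ≤ ε * s := by
    intro a ha v ε hε
    obtain ⟨σ, hσ, hfix, hder⟩ := hD.exists_isHolInvolution ha
    obtain ⟨K, t, ht, hK⟩ := hlip a ha
    have hδ : 0 < ε / ((K + 1) * (‖v‖ + 1)) := by positivity
    have hp : Filter.Tendsto (fun s : ℝ => a + s • v) (nhdsWithin 0 (Set.Ioi 0)) (nhds a) := by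
      have : Continuous fun s : ℝ => a + s • v := by fun_prop
      simpa using (this.tendsto 0).mono_left nhdsWithin_le_nhds
    have hn : Filter.Tendsto (fun s : ℝ => a - s • v) (nhdsWithin 0 (Set.Ioi 0)) (nhds a) := by
      have : Continuous fun s : ℝ => a - s • v := by fun_prop
      simpa using (this.tendsto 0).mono_left nhdsWithin_le_nhds
    have hσt : Filter.Tendsto σ (nhds a) (nhds a) := by
      have := hder.continuousAt.tendsto
      rwa [hfix] at this
    filter_upwards [hp.eventually (hder.isLittleO.def hδ), hp.eventually (hD.isOpen.mem_nhds ha),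
      (hσt.comp hp).eventually ht, hn.eventually ht, self_mem_nhdsWithin] with s h1 h2 h3 h4 h5
    have hs : (0 : ℝ) < s := h5
    have e1 : σ (a + s • v) - σ a - (-ContinuousLinearMap.id ℂ (Fin m → ℂ)) (a + s • v - a)
        = σ (a + s • v) - (a - s • v) := by
      rw [hfix, add_sub_cancel_left]
      simp only [_root_.neg_apply, ContinuousLinearMap.id_apply]
      abel
    rw [e1, add_sub_cancel_left, norm_smul, Real.norm_of_nonneg hs.le] at h1
    rw [← hinv σ hσ _ h2]
    have h6 := hK.dist_le_mul _ h3 _ h4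
    rw [Real.dist_eq, dist_eq_norm] at h6
    refine h6.trans ?_
    calc (K : ℝ) * ‖σ (a + s • v) - (a - s • v)‖
        ≤ (K + 1) * (ε / ((K + 1) * (‖v‖ + 1)) * (s * (‖v‖ + 1))) := by
          gcongr
          · linarith
          · refine h1.trans ?_
            gcongr
            linarith
      _ = ε * s := by field_simp
  obtain ⟨x, hx⟩ := hD.isConnected.nonempty
  refine ⟨q x, fun z hz => ?_⟩
  have h1 := eq_of_symmetric_deriv_eq_zero_of_isPreconnected hD.isOpen
    hD.isConnected.isPreconnected (fun a ha => by
      obtain ⟨K, t, ht, hK⟩ := hlip a ha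
      exact (hK.continuousOn.continuousAt ht).continuousWithinAt) hsym hx hz
  rw [h1, (G.det_eq_re hz).1]
  have h2 := (G.det_eq_re hz).2.ne'
  rw [← Complex.ofReal_mul]
  congr 1
  simp only [hq, hφ]
  field_simp

end KernelProportional

section Polarization

open MeasureTheory Metric

theorem differentiableOn_ball_of_forall_mem_dense {H G : Type*} [NormedAddCommGroup H]
    [NormedSpace ℂ H] [NormedAddCommGroup G] [NormedSpace ℂ G] [CompleteSpace G]
    {E : ℂ → H →L[ℂ] G} {c : ℂ} {R : NNReal} (hR : 0 < R)
    (hE : ContinuousOn E (closedBall c R)) {S : Set H} (hS : Dense S)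
    (hd : ∀ v ∈ S, DifferentiableOn ℂ (fun z => E z v) (ball c R)) :
    DifferentiableOn ℂ E (ball c R) := by
  have hci : CircleIntegrable E c R :=
    (hE.mono sphere_subset_closedBall).circleIntegrable R.coe_nonneg
  have han := (hasFPowerSeriesOn_cauchy_integral hci hR).differentiableOn
  rw [Metric.eball_coe] at han
  refine han.congr fun w hw => ?_
  refine ContinuousLinearMap.coeFn_injective
    (Continuous.ext_on hS (ContinuousLinearMap.continuous _) (ContinuousLinearMap.continuous _)
      fun v hv => ?_)
  have hne : ∀ z ∈ sphere c R, z - w ≠ 0 := fun z hz h => by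
    rw [sub_eq_zero] at h
    rw [h, mem_sphere] at hz
    rw [mem_ball] at hw
    exact hw.ne hz
  have hint : CircleIntegrable (fun z => (z - w)⁻¹ • E z) c R :=
    (((continuousOn_id.sub continuousOn_const).inv₀ hne).smul
      (hE.mono sphere_subset_closedBall)).circleIntegrable R.coe_nonneg
  have hcv : ContinuousOn (fun z => E z v) (closedBall c R) := hE.clm_apply continuousOn_const
  have hcauchy := two_pi_I_inv_smul_circleIntegral_sub_inv_smul_of_differentiable_on_off_countable
    countable_empty hw hcv fun x hx => (hd v hv).differentiableAt (isOpen_ball.mem_nhds hx.1)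
  rw [← hcauchy, smul_apply]
  congr 1
  have := (ContinuousLinearMap.apply ℂ G v).intervalIntegral_comp_comm hint.out
  simp only [circleIntegral, ContinuousLinearMap.apply_apply,
    smul_apply] at this ⊢
  exact this

theorem Submodule.dense_sup_orthogonal {H : Type*} [NormedAddCommGroup H] [InnerProductSpace ℂ H]
    [CompleteSpace H] (B : Submodule ℂ H) : Dense ((B ⊔ Bᗮ : Submodule ℂ H) : Set H) := by
  rw [Submodule.dense_iff_topologicalClosure_eq_top, Submodule.topologicalClosure_eq_top_iff,
    ← Submodule.inf_orthogonal, Submodule.inf_orthogonal_eq_bot]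

theorem differentiableOn_toDual_of_weak {H : Type*} [NormedAddCommGroup H] [InnerProductSpace ℂ H]
    [CompleteSpace H] {B : Submodule ℂ H} {κ : ℂ → H} {c : ℂ} {R : NNReal} (hR : 0 < R)
    (hκ : ContinuousOn κ (closedBall c R)) (hB : ∀ z ∈ ball c R, κ z ∈ B.topologicalClosure)
    (hd : ∀ v ∈ B, DifferentiableOn ℂ (fun z => inner ℂ (κ z) v) (ball c R)) :
    DifferentiableOn ℂ (fun z => InnerProductSpace.toDual ℂ H (κ z)) (ball c R) := by
  refine differentiableOn_ball_of_forall_mem_dense hR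
    ((InnerProductSpace.toDual ℂ H).continuous.comp_continuousOn hκ) B.dense_sup_orthogonal
    fun v hv => ?_
  obtain ⟨x, hx, y, hy, rfl⟩ := Submodule.mem_sup.1 hv
  refine (hd x hx).congr fun z hz => ?_
  have hy' : inner ℂ (κ z) y = 0 :=
    Submodule.inner_right_of_mem_orthogonal (hB z hz) (by rwa [Submodule.orthogonal_closure])
  rw [InnerProductSpace.toDual_apply_apply, inner_add_right, hy', add_zero]

theorem eqOn_zero_of_ofReal_eq_zero {g : ℂ → ℂ} {ρ : ℝ} (hρ : 0 < ρ)
    (hg : DifferentiableOn ℂ g (ball 0 ρ)) (h0 : ∀ s : ℝ, |s| < ρ → g s = 0) :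
    EqOn g 0 (ball 0 ρ) := by
  refine (hg.analyticOnNhd isOpen_ball).eqOn_zero_of_preconnected_of_frequently_eq_zero
    (convex_ball _ _).isPreconnected (mem_ball_self hρ) ?_
  have ht : Filter.Tendsto (fun s : ℝ => (s : ℂ)) (nhdsWithin 0 (Ioi 0)) (nhdsWithin 0 {0}ᶜ) := by
    refine tendsto_nhdsWithin_iff.2 ⟨?_, ?_⟩
    · exact (Complex.continuous_ofReal.tendsto' 0 0 rfl).mono_left nhdsWithin_le_nhds
    · filter_upwards [self_mem_nhdsWithin] with s hs
      simpa using (mem_Ioi.1 hs).ne'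
  refine ht.frequently (Filter.Eventually.frequently ?_)
  filter_upwards [Ioo_mem_nhdsGT hρ] with s hs
  exact h0 s (by rw [abs_of_pos hs.1]; exact hs.2)

theorem eq_zero_of_eq_zero_on_conj {F : ℂ × ℂ → ℂ} {ρ : ℝ} (hρ : 0 < ρ)
    (hF : DifferentiableOn ℂ F (ball 0 ρ ×ˢ ball 0 ρ))
    (h0 : ∀ z ∈ ball (0 : ℂ) ρ, F (z, starRingEnd ℂ z) = 0) {ζ η : ℂ} (hζ : ζ ∈ ball (0 : ℂ) (ρ / 2))
    (hη : η ∈ ball (0 : ℂ) (ρ / 2)) : F (ζ, η) = 0 := by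
  have hmem : ∀ s t : ℂ, ‖s‖ < ρ / 2 → ‖t‖ < ρ / 2 →
      (s + t * I, s - t * I) ∈ ball (0 : ℂ) ρ ×ˢ ball (0 : ℂ) ρ := fun s t hs ht => by
    have hI : ‖t * I‖ = ‖t‖ := by simp
    refine ⟨mem_ball_zero_iff.2 ?_, mem_ball_zero_iff.2 ?_⟩
    · exact (norm_add_le _ _).trans_lt (by linarith)
    · exact (norm_sub_le _ _).trans_lt (by linarith)
  have hreal : ∀ s : ℂ, ‖s‖ < ρ / 2 → ∀ t : ℝ, |t| < ρ / 2 → F (s + t * I, s - t * I) = 0 := by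
    intro s hs t ht
    have ht' : ‖(t : ℂ)‖ < ρ / 2 := by simpa using ht
    refine eqOn_zero_of_ofReal_eq_zero (g := fun s => F (s + t * I, s - t * I)) (half_pos hρ)
      (hF.comp (by fun_prop) fun s hs => hmem s t (mem_ball_zero_iff.1 hs) ht') (fun s hs => ?_)
      (mem_ball_zero_iff.2 hs)
    have := h0 (s + t * I) (hmem s t (by simpa using hs) ht').1
    simpa [sub_eq_add_neg] using this
  have hcomplex : ∀ s t : ℂ, ‖s‖ < ρ / 2 → ‖t‖ < ρ / 2 → F (s + t * I, s - t * I) = 0 :=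
    fun s t hs ht => eqOn_zero_of_ofReal_eq_zero (g := fun t => F (s + t * I, s - t * I))
      (half_pos hρ) (hF.comp (by fun_prop) fun t ht => hmem s t hs (mem_ball_zero_iff.1 ht))
      (fun t ht => hreal s hs t ht) (mem_ball_zero_iff.2 ht)
  rw [mem_ball_zero_iff] at hζ hη
  have h1 : ‖(ζ + η) / 2‖ < ρ / 2 := by
    rw [norm_div, Complex.norm_ofNat]
    linarith [norm_add_le ζ η]
  have h2 : ‖(ζ - η) / (2 * I)‖ < ρ / 2 := by
    rw [norm_div, norm_mul, Complex.norm_I, Complex.norm_ofNat]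
    linarith [norm_sub_le ζ η]
  have h := hcomplex _ _ h1 h2
  have e : (ζ - η) / (2 * I) * I = (ζ - η) / 2 := by
    field_simp
  rw [e] at h
  convert h using 3 <;> ring

theorem inner_eq_sum_of_norm_sq_eq_sum {H J : Type*} [NormedAddCommGroup H]
    [InnerProductSpace ℂ H] [CompleteSpace H] [Fintype J] {κ : ℂ → H} {P Q : J → ℂ → ℂ} {ρ : ℝ}
    (hρ : 0 < ρ)
    (hκ : DifferentiableOn ℂ (fun z => InnerProductSpace.toDual ℂ H (κ z)) (ball 0 ρ))
    (hP : ∀ j, DifferentiableOn ℂ (P j) (ball 0 ρ)) (hQ : ∀ j, DifferentiableOn ℂ (Q j) (ball 0 ρ))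
    (h : ∀ z ∈ ball (0 : ℂ) ρ, ((‖κ z‖ ^ 2 : ℝ) : ℂ) = ∑ j, P j z * starRingEnd ℂ (Q j z))
    {ζ ω : ℂ} (hζ : ζ ∈ ball (0 : ℂ) (ρ / 2)) (hω : ω ∈ ball (0 : ℂ) (ρ / 2)) :
    inner ℂ (κ ζ) (κ ω) = ∑ j, P j ζ * starRingEnd ℂ (Q j ω) := by
  have hconj : ∀ z ∈ ball (0 : ℂ) ρ, starRingEnd ℂ z ∈ ball (0 : ℂ) ρ := fun z hz => by
    simpa using hz
  have hκ' : DifferentiableOn ℂ (fun z => κ (starRingEnd ℂ z)) (ball 0 ρ) := fun z hz => by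
    have h1 := ((hκ.differentiableAt (isOpen_ball.mem_nhds (hconj z hz))).comp_semilinear₁
      (starRingEnd ℂ) (InnerProductSpace.toDual ℂ H).symm.toContinuousLinearEquiv.toContinuousLinearMap)
    rw [Complex.conj_conj] at h1
    refine DifferentiableAt.differentiableWithinAt (h1.congr_of_eventuallyEq (.of_forall fun x => ?_))
    simp
  have hQ' : ∀ j, DifferentiableOn ℂ (fun z => starRingEnd ℂ (Q j (starRingEnd ℂ z))) (ball 0 ρ) :=
    fun j z hz => by
      have h1 := ((hQ j).differentiableAt
        (isOpen_ball.mem_nhds (hconj z hz))).comp_ringHom (starRingEnd ℂ) (starRingEnd ℂ)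
      rw [Complex.conj_conj] at h1
      exact h1.differentiableWithinAt
  have hfst : MapsTo (Prod.fst : ℂ × ℂ → ℂ) (ball 0 ρ ×ˢ ball 0 ρ) (ball 0 ρ) := fun _ hx => hx.1
  have hsnd : MapsTo (Prod.snd : ℂ × ℂ → ℂ) (ball 0 ρ ×ˢ ball 0 ρ) (ball 0 ρ) := fun _ hx => hx.2
  have key := eq_zero_of_eq_zero_on_conj (ζ := ζ) (η := starRingEnd ℂ ω)
    (F := fun x => InnerProductSpace.toDual ℂ H (κ x.1) (κ (starRingEnd ℂ x.2)) -
      ∑ j, P j x.1 * starRingEnd ℂ (Q j (starRingEnd ℂ x.2))) hρ ?_ ?_ hζ (by simpa using hω)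
  · simpa [sub_eq_zero] using key
  · refine DifferentiableOn.sub ?_ (DifferentiableOn.fun_sum fun j _ => ?_)
    · exact (hκ.comp differentiableOn_fst hfst).clm_apply (hκ'.comp differentiableOn_snd hsnd)
    · exact ((hP j).comp differentiableOn_fst hfst).mul ((hQ' j).comp differentiableOn_snd hsnd)
  · intro z hz
    simp only [Complex.conj_conj, InnerProductSpace.toDual_apply_apply, ← h z hz, sub_eq_zero]
    rw [inner_self_eq_norm_sq_to_K]
    push_cast
    rfl

theorem card_le_of_inner_eq_sum {H J L : Type*} [NormedAddCommGroup H] [InnerProductSpace ℂ H]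
    [Fintype J] [Fintype L] {κ : L → H} (hκ : LinearIndependent ℂ κ) {p q : L → J → ℂ}
    (h : ∀ l l', inner ℂ (κ l) (κ l') = ∑ j, p l j * q l' j) :
    Fintype.card L ≤ Fintype.card J := by
  suffices hq : LinearIndependent ℂ q by simpa using hq.fintype_card_le_finrank
  refine Fintype.linearIndependent_iff.2 fun β hβ => ?_
  refine Fintype.linearIndependent_iff.1 hκ β ?_
  have hz : ∀ l, inner ℂ (κ l) (∑ l', β l' • κ l') = 0 := fun l => by
    have hj : ∀ j, ∑ l', β l' * q l' j = 0 := fun j => by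
      simpa using congrFun hβ j
    simp_rw [inner_sum, inner_smul_right, h, Finset.mul_sum]
    rw [Finset.sum_comm]
    refine Finset.sum_eq_zero fun j _ => ?_
    rw [← mul_zero (p l j), ← hj j, Finset.mul_sum]
    exact Finset.sum_congr rfl fun _ _ => by ring
  rw [← inner_self_eq_zero (𝕜 := ℂ), sum_inner]
  exact Finset.sum_eq_zero fun l _ => by rw [inner_smul_left, hz, mul_zero]

theorem IsBergmanKernel.linearIndependent {ι L : Type*} [Fintype ι] [Fintype L] {D : Set (ι → ℂ)}
    {k : (ι → ℂ) → Lp ℂ 2 (volume.restrict D)} (hk : IsBergmanKernel D k) (hD : IsOpen D)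
    (hb : Bornology.IsBounded D) {x : L → ι → ℂ} (hx : ∀ l, x l ∈ D) {i : ι}
    (hinj : Function.Injective fun l => x l i) : LinearIndependent ℂ fun l => k (x l) := by
  refine Fintype.linearIndependent_iff.2 fun β hβ l₀ => ?_
  set f : (ι → ℂ) → ℂ := fun z => ∏ l ∈ Finset.univ.erase l₀, (z i - x l i) with hf
  have hfd : Differentiable ℂ f := by
    rw [hf]
    fun_prop
  have hfc : Continuous f := hfd.continuous
  obtain ⟨C, hC⟩ := (hb.isCompact_closure.image hfc).isBounded.exists_norm_le
  have : IsFiniteMeasure (volume.restrict D) :=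
    ⟨by rw [Measure.restrict_apply_univ]; exact hb.measure_lt_top⟩
  have hfm : MemLp f 2 (volume.restrict D) := MemLp.of_bound hfc.aestronglyMeasurable C
    ((ae_restrict_mem hD.measurableSet).mono fun z hz => hC _ ⟨z, subset_closure hz, rfl⟩)
  have h0 : inner ℂ (∑ l, β l • k (x l)) (hfm.toLp f) = 0 := by rw [hβ, inner_zero_left]
  rw [sum_inner, Finset.sum_eq_single l₀] at h0
  · rw [inner_smul_left, hk.inner_toLp _ (hx l₀) f hfm hfd.differentiableOn, mul_eq_zero] at h0
    refine (map_eq_zero _).1 (h0.resolve_right ?_)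
    refine Finset.prod_ne_zero_iff.2 fun l hl => sub_ne_zero.2 fun h => ?_
    exact (Finset.mem_erase.1 hl).1 (hinj h.symm)
  · intro l _ hl
    have hfl : f (x l) = 0 :=
      Finset.prod_eq_zero (Finset.mem_erase.2 ⟨hl, Finset.mem_univ l⟩) (sub_self (x l i))
    rw [inner_smul_left, hk.inner_toLp _ (hx l) f hfm hfd.differentiableOn, hfl, mul_zero]
  · exact fun h => absurd (Finset.mem_univ _) h

theorem IsBergmanKernel.not_norm_sq_eq_sum {ι J : Type*} [Fintype ι] [Nonempty ι] [Fintype J]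
    {D : Set (ι → ℂ)} {k : (ι → ℂ) → Lp ℂ 2 (volume.restrict D)} (hk : IsBergmanKernel D k)
    (hD : IsOpen D) (hne : D.Nonempty) (hb : Bornology.IsBounded D) {P Q : J → (ι → ℂ) → ℂ}
    (hP : ∀ j, DifferentiableOn ℂ (P j) D) (hQ : ∀ j, DifferentiableOn ℂ (Q j) D) :
    ¬ ∀ z ∈ D, ((‖k z‖ ^ 2 : ℝ) : ℂ) = ∑ j, P j z * starRingEnd ℂ (Q j z) := by
  intro h
  obtain ⟨a, ha⟩ := hne
  obtain ⟨i⟩ := ‹Nonempty ι›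
  obtain ⟨r, hr, C, hrD, hC⟩ := hk.exists_local_lipschitz hD ha
  set ℓ : ℂ → ι → ℂ := fun ζ => a + ζ • Pi.single i 1 with hℓ
  have hℓd : Differentiable ℂ ℓ := by
    rw [hℓ]
    fun_prop
  obtain ⟨ρ, hρ, hℓr⟩ := Metric.nhds_basis_closedBall.mem_iff.1
    (hℓd.continuous.continuousAt.preimage_mem_nhds (x := 0) (t := ball a r)
      (by simpa [hℓ] using ball_mem_nhds a hr))
  lift ρ to NNReal using hρ.le
  have hℓD : MapsTo ℓ (ball 0 ρ) D := fun z hz => hrD (hℓr (ball_subset_closedBall hz))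
  have hkc : ContinuousOn k (ball a r) :=
    (LipschitzOnWith.of_dist_le_mul (K := C.toNNReal) fun z hz w hw => by
      rw [dist_eq_norm, dist_eq_norm]
      exact (hC z hz w hw).trans (by gcongr; exact Real.le_coe_toNNReal C)).continuousOn
  have hdual := differentiableOn_toDual_of_weak (B := bergmanSpace D) (κ := k ∘ ℓ) (c := 0)
    (NNReal.coe_pos.1 hρ) (hkc.comp hℓd.continuous.continuousOn hℓr)
    (fun z hz => hk.mem_closure _ (hℓD hz)) fun v hv => by
      obtain ⟨f, hf, hd, rfl⟩ := exists_of_mem_bergmanSpace hv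
      exact (hd.comp hℓd.differentiableOn hℓD).congr fun z hz => hk.inner_toLp _ (hℓD hz) f hf hd
  set ω : Fin (Fintype.card J + 1) → ℂ := fun l => ((ρ / (l + 3) : ℝ) : ℂ) with hω
  have hωmem : ∀ l, ω l ∈ ball (0 : ℂ) (ρ / 2) := fun l => by
    rw [mem_ball_zero_iff, hω, Complex.norm_real, Real.norm_of_nonneg (by positivity)]
    exact div_lt_div_of_pos_left hρ two_pos (by linarith [Nat.cast_nonneg (α := ℝ) (l : ℕ)])
  have hωinj : Function.Injective ω := fun l l' hl => by
    have hl' : (ρ / (l + 3) : ℝ) = ρ / (l' + 3) := Complex.ofReal_injective hl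
    rw [div_eq_mul_inv, div_eq_mul_inv, mul_right_inj' hρ.ne', inv_inj] at hl'
    exact Fin.ext (by exact_mod_cast add_right_cancel hl')
  have hind := hk.linearIndependent hD hb (x := fun l => ℓ (ω l)) (i := i)
    (fun l => hℓD (ball_subset_ball (by linarith) (hωmem l)))
    fun l l' hl => hωinj (by simpa [hℓ] using hl)
  have := card_le_of_inner_eq_sum hind (p := fun l j => P j (ℓ (ω l)))
    (q := fun l j => starRingEnd ℂ (Q j (ℓ (ω l)))) fun l l' =>
      inner_eq_sum_of_norm_sq_eq_sum (κ := k ∘ ℓ) (P := fun j => P j ∘ ℓ) (Q := fun j => Q j ∘ ℓ)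
        hρ hdual (fun j => (hP j).comp hℓd.differentiableOn hℓD)
        (fun j => (hQ j).comp hℓd.differentiableOn hℓD) (fun z hz => h _ (hℓD hz))
        (hωmem l) (hωmem l')
  simp at this

end Polarization

/-!
STATEMENT 9: for a bounded symmetric domain `D ⋐ ℂ^m` with a canonical Kähler metric `g'_D`,
the function `φ_m(w) = det((g'_D)_{s t̄}(w))` does not lie in the Umehara algebra Λ(D).
-/
theorem stmt9 {m : ℕ} (hm : 0 < m) (D : Set (Fin m → ℂ)) (hD : IsBddSymmDomain D)
    (G : HermMetricOn D) (hG : IsCanonicalKahlerMetric D G) :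
    ¬ UmeharaMem D (fun w => (G.g w).det) := by
  rintro ⟨r, c, f, g, hf, hg, hfg⟩
  obtain ⟨k, hk⟩ := exists_isBergmanKernel hD.isOpen
  obtain ⟨C, hC⟩ := exists_norm_sq_kernel_eq hD hG hk
  have : Nonempty (Fin m) := ⟨⟨0, hm⟩⟩
  refine hk.not_norm_sq_eq_sum hD.isOpen hD.isConnected.nonempty hD.isBounded
    (P := Sum.elim (fun j z => C * c j * f j z) fun j z => C * c j * g j z)
    (Q := Sum.elim g f) ?_ ?_ fun z hz => ?_
  · rintro (j | j)
    · exact (hf j).const_mul _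
    · exact (hg j).const_mul _
  · rintro (j | j)
    · exact hg j
    · exact hf j
  · have hz' : (G.g z).det = _ := hfg z hz
    rw [hC z hz, hz', Fintype.sum_sum_type, ← Finset.sum_add_distrib, Finset.mul_sum]
    exact Finset.sum_congr rfl fun j _ => by simp only [Sum.elim_inl, Sum.elim_inr]; ring
end
end
end

section
/- Let (M, ω_M) be a Hermitian manifold whose anti-canonical bundle (K_M^*, det g_M) is positive, and let (N, ω_N) be a Hermitian manifold of semi-negative holomorphic bisectional curvature. Then for any real λ > 0 and any integer 1 ≤ p ≤ min{dim_ℂ M, dim_ℂ N}, there does not exist a germ of holomorphic map F : (M; x₀) → (N; F(x₀)) with F^* ω_N^p = λ ω_M^p. -/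
open scoped Classical ComplexOrder
open Complex Set

noncomputable section

/-- Positivity of the Hermitian holomorphic line bundle `(K_M^*, det g_M)`: the Chern curvature
form `-∂∂̄ log det g` of the anti-canonical bundle is a positive (1,1)-form on `U`. -/
def AnticanonicalPositive {ι : Type*} [Fintype ι] [DecidableEq ι]
    (U : Set (ι → ℂ)) (g : (ι → ℂ) → Matrix ι ι ℂ) : Prop :=
  ∀ z ∈ U, ∀ v : ι → ℂ, v ≠ 0 →
    0 < (∑ k, ∑ l,
      (-(wdz k (fun w => wdzbar l (fun w' => Complex.log ((g w').det)) w) z))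
        * v k * (starRingEnd ℂ) (v l)).re

/-- The curvature tensor `R_{i j̄ k l̄}` of the Chern connection of the Hermitian metric `g`:
`R_{i j̄ k l̄} = -∂_k ∂̄_l g_{i j̄} + Σ_{p,q} g^{q p̄} (∂_k g_{i q̄})(∂̄_l g_{p j̄})`. -/
def chernCurv {ι : Type*} [Fintype ι] [DecidableEq ι]
    (g : (ι → ℂ) → Matrix ι ι ℂ) (z : ι → ℂ) (i j k l : ι) : ℂ :=
  -(wdz k (fun w => wdzbar l (fun w' => g w' i j) w) z)
    + ∑ p, ∑ q, (g z)⁻¹ q p * wdz k (fun w => g w i q) z * wdzbar l (fun w => g w p j) z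

/-- Holomorphic bisectional curvature `R(v, v̄, ξ, ξ̄)` of `g` at `z` along `v, ξ`. -/
def bisect {ι : Type*} [Fintype ι] [DecidableEq ι]
    (g : (ι → ℂ) → Matrix ι ι ℂ) (z : ι → ℂ) (v ξ : ι → ℂ) : ℂ :=
  ∑ i, ∑ j, ∑ k, ∑ l, chernCurv g z i j k l
    * v i * (starRingEnd ℂ) (v j) * ξ k * (starRingEnd ℂ) (ξ l)

/-- Semi-negative holomorphic bisectional curvature on `U`. -/
def SemiNegBisectional {ι : Type*} [Fintype ι] [DecidableEq ι]
    (U : Set (ι → ℂ)) (g : (ι → ℂ) → Matrix ι ι ℂ) : Prop :=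
  ∀ z ∈ U, ∀ v ξ : ι → ℂ, (bisect g z v ξ).re ≤ 0


section Minors

variable {m p : ℕ}

/-- Minors on increasing multi-indices determine the minors on arbitrary multi-indices. -/
theorem minors_eq_of_strictMono {A B : Matrix (Fin m) (Fin m) ℂ} {c : ℂ}
    (h : ∀ L K : Fin p → Fin m, StrictMono L → StrictMono K →
      (A.submatrix L K).det = c * (B.submatrix L K).det) (L K : Fin p → Fin m) :
    (A.submatrix L K).det = c * (B.submatrix L K).det := by
  by_cases hL : Function.Injective L
  swap
  · obtain ⟨i, j, hij, hne⟩ : ∃ i j, L i = L j ∧ i ≠ j := by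
      simpa [Function.Injective] using hL
    rw [Matrix.det_zero_of_row_eq hne, Matrix.det_zero_of_row_eq hne, mul_zero] <;>
      ext k <;> simp [hij]
  by_cases hK : Function.Injective K
  swap
  · obtain ⟨i, j, hij, hne⟩ : ∃ i j, K i = K j ∧ i ≠ j := by
      simpa [Function.Injective] using hK
    rw [Matrix.det_zero_of_column_eq hne, Matrix.det_zero_of_column_eq hne, mul_zero] <;>
      intro k <;> simp [hij]
  have key : ∀ X : Matrix (Fin m) (Fin m) ℂ,
      (X.submatrix (L ∘ Tuple.sort L) (K ∘ Tuple.sort K)).det =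
        (((Tuple.sort K).sign : ℤ) : ℂ) * ((((Tuple.sort L).sign : ℤ) : ℂ) *
          (X.submatrix L K).det) := by
    intro X
    rw [← Matrix.det_permute, ← Matrix.det_permute']
    rfl
  have hs := h (L ∘ Tuple.sort L) (K ∘ Tuple.sort K)
    ((Tuple.monotone_sort L).strictMono_of_injective (hL.comp (Equiv.injective _)))
    ((Tuple.monotone_sort K).strictMono_of_injective (hK.comp (Equiv.injective _)))
  rw [key, key] at hs
  have e : ∀ σ : Equiv.Perm (Fin p), (((σ.sign : ℤ) : ℂ)) ≠ 0 := fun σ => by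
    exact_mod_cast (Int.cast_ne_zero (α := ℂ)).2 (Units.ne_zero σ.sign)
  refine mul_left_cancel₀ (e (Tuple.sort L)) (mul_left_cancel₀ (e (Tuple.sort K)) ?_)
  rw [hs]; ring

/-- Expansion of a minor of a product. -/
theorem det_submatrix_mul (P A : Matrix (Fin m) (Fin m) ℂ) (L K : Fin p → Fin m) :
    ((P * A).submatrix L K).det =
      ∑ a : Fin p → Fin m, (∏ i, P (L i) (a i)) * (A.submatrix a K).det := by
  have h1 : (P * A).submatrix L K =
      Matrix.of fun i => ∑ j, P (L i) j • fun k => A j (K k) := by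
    ext i k
    simp [Matrix.mul_apply]
  have h2 := (Matrix.detRowAlternating (R := ℂ) (n := Fin p)).toMultilinearMap.map_sum
    (fun (i : Fin p) (j : Fin m) => P (L i) j • fun k => A j (K k))
  rw [h1]
  refine h2.trans (Finset.sum_congr rfl fun a _ => ?_)
  exact ((Matrix.detRowAlternating (R := ℂ) (n := Fin p)).toMultilinearMap.map_smul_univ
    (fun i => P (L i) (a i)) (fun i k => A (a i) (K k)))

theorem minors_eq_mul_left {A B : Matrix (Fin m) (Fin m) ℂ} {c : ℂ}
    (h : ∀ L K : Fin p → Fin m, (A.submatrix L K).det = c * (B.submatrix L K).det)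
    (P : Matrix (Fin m) (Fin m) ℂ) (L K : Fin p → Fin m) :
    ((P * A).submatrix L K).det = c * ((P * B).submatrix L K).det := by
  rw [det_submatrix_mul, det_submatrix_mul, Finset.mul_sum]
  exact Finset.sum_congr rfl fun a _ => by rw [h]; ring

theorem minors_eq_mul_right {A B : Matrix (Fin m) (Fin m) ℂ} {c : ℂ}
    (h : ∀ L K : Fin p → Fin m, (A.submatrix L K).det = c * (B.submatrix L K).det)
    (P : Matrix (Fin m) (Fin m) ℂ) (L K : Fin p → Fin m) :
    ((A * P).submatrix L K).det = c * ((B * P).submatrix L K).det := by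
  have ht : ∀ (X : Matrix (Fin m) (Fin m) ℂ) (L K : Fin p → Fin m),
      (X.transpose.submatrix L K).det = (X.submatrix K L).det := fun X L K => by
    rw [← Matrix.det_transpose]; rfl
  have := minors_eq_mul_left (A := A.transpose) (B := B.transpose) (c := c)
    (fun L K => by rw [ht, ht, h]) P.transpose K L
  rwa [← Matrix.transpose_mul, ← Matrix.transpose_mul, ht, ht] at this

open scoped MatrixOrder Matrix.Norms.L2Operator in
theorem exists_eq_conjTranspose_mul_self {ι : Type*} [Fintype ι] {A : Matrix ι ι ℂ}
    (hA : A.PosSemidef) : ∃ B : Matrix ι ι ℂ, A = B.conjTranspose * B :=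
  CStarAlgebra.nonneg_iff_eq_star_mul_self.mp hA.nonneg

/-- If the `p × p` minors of two Hermitian matrices are proportional, one of the matrices being
positive definite, so are their determinants, with a constant that depends only on the factor. -/
theorem det_pow_eq_of_minors (hm : 0 < m) (hpm : p ≤ m) {A G : Matrix (Fin m) (Fin m) ℂ} {c : ℂ}
    (hA : A.IsHermitian) (hG : G.PosDef)
    (h : ∀ L K : Fin p → Fin m, StrictMono L → StrictMono K →
      (A.submatrix L K).det = c * (G.submatrix L K).det) :
    A.det ^ p = c ^ m * G.det ^ p := by
  have : NeZero m := ⟨hm.ne'⟩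
  obtain ⟨B, hB⟩ := exists_eq_conjTranspose_mul_self hG.posSemidef
  have hBdet : IsUnit B.det := by
    have := hG.det_pos.ne'
    rw [hB, Matrix.det_mul] at this
    exact (right_ne_zero_of_mul this).isUnit
  have hC : (B⁻¹.conjTranspose * A * B⁻¹).IsHermitian :=
    Matrix.isHermitian_conjTranspose_mul_mul _ hA
  set Uu : Matrix (Fin m) (Fin m) ℂ := hC.eigenvectorUnitary.1 with hUu
  have hU : Uu.conjTranspose * Uu = 1 := by
    rw [hUu, ← Matrix.star_eq_conjTranspose]; exact Unitary.coe_star_mul_self _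
  obtain ⟨d, hd⟩ : ∃ d : Fin m → ℂ,
      Uu.conjTranspose * (B⁻¹.conjTranspose * A * B⁻¹) * Uu = Matrix.diagonal d := by
    refine ⟨RCLike.ofReal ∘ hC.eigenvalues, ?_⟩
    conv_lhs => rw [hC.spectral_theorem, Unitary.conjStarAlgAut_apply]
    rw [← hUu, Matrix.star_eq_conjTranspose]
    calc _ = (Uu.conjTranspose * Uu) * Matrix.diagonal (RCLike.ofReal ∘ hC.eigenvalues) *
          (Uu.conjTranspose * Uu) := by simp only [Matrix.mul_assoc]
      _ = _ := by rw [hU, Matrix.one_mul, Matrix.mul_one]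
  set Q := B⁻¹ * Uu with hQ
  have hQA : Q.conjTranspose * A * Q = Matrix.diagonal d := by
    rw [← hd, hQ, Matrix.conjTranspose_mul]; simp only [Matrix.mul_assoc]
  have hBB : B * B⁻¹ = 1 := Matrix.mul_nonsing_inv _ hBdet
  have hQG : Q.conjTranspose * G * Q = 1 := by
    calc _ = Uu.conjTranspose * ((B * B⁻¹).conjTranspose * (B * B⁻¹)) * Uu := by
          rw [hQ, hB, Matrix.conjTranspose_mul, Matrix.conjTranspose_mul]
          simp only [Matrix.mul_assoc]
      _ = 1 := by rw [hBB]; simp [hU]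
  have hmin := minors_eq_mul_right (minors_eq_mul_left (minors_eq_of_strictMono h)
    Q.conjTranspose) Q
  rw [hQA, hQG] at hmin
  have hwin : ∀ s : Fin m, ∏ i : Fin p, d (Fin.castLE hpm i + s) = c := fun s => by
    have hinj : Function.Injective fun i : Fin p => Fin.castLE hpm i + s :=
      (add_left_injective s).comp (Fin.castLE_injective hpm)
    have := hmin (fun i => Fin.castLE hpm i + s) (fun i => Fin.castLE hpm i + s)
    rw [Matrix.submatrix_diagonal _ _ hinj, Matrix.submatrix_one _ hinj, Matrix.det_one,
      Matrix.det_diagonal, mul_one] at this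
    exact this
  have hprod : (∏ i, d i) ^ p = c ^ m := by
    calc (∏ i, d i) ^ p = ∏ i : Fin p, ∏ s : Fin m, d (Fin.castLE hpm i + s) := by
          rw [Finset.prod_congr rfl fun (i : Fin p) _ =>
            Fintype.prod_equiv (Equiv.addLeft (Fin.castLE hpm i))
              (fun s => d (Fin.castLE hpm i + s)) d fun _ => rfl]
          simp
      _ = c ^ m := by
          rw [Finset.prod_comm, Finset.prod_congr rfl fun s _ => hwin s]
          simp
  have e1 := congrArg Matrix.det hQA
  have e2 := congrArg Matrix.det hQG
  rw [Matrix.det_mul, Matrix.det_mul, Matrix.det_diagonal] at e1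
  rw [Matrix.det_mul, Matrix.det_mul, Matrix.det_one] at e2
  have hQ0 : Q.conjTranspose.det * Q.det ≠ 0 := fun h0 => one_ne_zero (α := ℂ) <| by
    rw [← e2]; linear_combination G.det * h0
  refine mul_left_cancel₀ (pow_ne_zero p hQ0) ?_
  calc _ = (Q.conjTranspose.det * A.det * Q.det) ^ p := by ring
    _ = c ^ m * (Q.conjTranspose.det * G.det * Q.det) ^ p := by rw [e1, e2, hprod]; simp
    _ = _ := by ring

end Minors

section PartialDeriv

open Metric Filter Topology

/-- A Schwarz-type estimate for difference quotients of a bounded holomorphic function. -/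
theorem dist_dslope_deriv_le {h : ℂ → ℂ} {r M : ℝ} (hr : 0 < r)
    (hd : DifferentiableOn ℂ h (ball 0 r)) (hM : ∀ s ∈ ball (0 : ℂ) r, ‖h s‖ ≤ M)
    {s : ℂ} (hs : s ∈ ball (0 : ℂ) r) :
    dist (dslope h 0 s) (deriv h 0) ≤ (2 * (2 * M / r) / r) * ‖s‖ := by
  have h0 : (0 : ℂ) ∈ ball (0 : ℂ) r := mem_ball_self hr
  have hmaps : MapsTo h (ball 0 r) (closedBall (h 0) (2 * M)) := fun z hz => by
    rw [mem_closedBall, dist_eq_norm]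
    linarith [norm_sub_le (h z) (h 0), hM z hz, hM 0 h0]
  have hb : ∀ z ∈ ball (0 : ℂ) r, ‖dslope h 0 z‖ ≤ 2 * M / r := fun z hz =>
    Complex.norm_dslope_le_div_of_mapsTo_ball hd hmaps hz
  have hd' : DifferentiableOn ℂ (dslope h 0) (ball 0 r) :=
    (Complex.differentiableOn_dslope (isOpen_ball.mem_nhds h0)).2 hd
  have hmaps' : MapsTo (dslope h 0) (ball 0 r)
      (closedBall (dslope h 0 0) (2 * (2 * M / r))) := fun z hz => by
    rw [mem_closedBall, dist_eq_norm]
    linarith [norm_sub_le (dslope h 0 z) (dslope h 0 0), hb z hz, hb 0 h0]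
  simpa using Complex.dist_le_div_mul_dist_of_mapsTo_ball hd' hmaps' hs

/-- Directional derivatives of a holomorphic function of several variables are holomorphic along
complex lines. -/
theorem analyticAt_fderiv_line {E : Type*} [NormedAddCommGroup E] [NormedSpace ℂ E]
    {W : Set E} (hW : IsOpen W) {f : E → ℂ} (hf : DifferentiableOn ℂ f W) {x : E} (hx : x ∈ W)
    (e v : E) : AnalyticAt ℂ (fun t : ℂ => fderiv ℂ f (x + t • e) v) 0 := by
  have hcont : Continuous fun q : ℂ × ℂ => x + q.1 • e + q.2 • v := by fun_prop
  have hfx : ContinuousAt f x := (hf.differentiableAt (hW.mem_nhds hx)).continuousAt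
  obtain ⟨r, hr, hball⟩ : ∃ r > 0, ∀ t ∈ ball (0 : ℂ) r, ∀ s ∈ ball (0 : ℂ) r,
      x + t • e + s • v ∈ W ∧ ‖f (x + t • e + s • v)‖ ≤ ‖f x‖ + 1 := by
    have h1 : ∀ᶠ y in 𝓝 x, y ∈ W ∧ ‖f y‖ ≤ ‖f x‖ + 1 :=
      (hW.eventually_mem hx).and
        ((hfx.norm.eventually_lt continuousAt_const (lt_add_one _)).mono fun _ h => h.le)
    have h2 : ∀ᶠ q in 𝓝 ((0, 0) : ℂ × ℂ), x + q.1 • e + q.2 • v ∈ W ∧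
        ‖f (x + q.1 • e + q.2 • v)‖ ≤ ‖f x‖ + 1 :=
      (hcont.tendsto' (0, 0) x (by simp)).eventually h1
    obtain ⟨r, hr, h3⟩ := Metric.eventually_nhds_iff_ball.1 h2
    refine ⟨r, hr, fun t ht s hs => h3 (t, s) ?_⟩
    rw [← ball_prod_same]
    exact ⟨ht, hs⟩
  have hline : ∀ t ∈ ball (0 : ℂ) r, ∀ s ∈ ball (0 : ℂ) r,
      HasDerivAt (fun s : ℂ => f (x + t • e + s • v)) (fderiv ℂ f (x + t • e + s • v) v) s := by
    intro t ht s hs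
    have hg : HasDerivAt (fun s : ℂ => x + t • e + s • v) v s := by
      simpa using ((hasDerivAt_id s).smul_const v).const_add (x + t • e)
    exact (hf.differentiableAt (hW.mem_nhds (hball t ht s hs).1)).hasFDerivAt.comp_hasDerivAt s hg
  have h0r : (0 : ℂ) ∈ ball (0 : ℂ) r := mem_ball_self hr
  have hderiv : ∀ t ∈ ball (0 : ℂ) r,
      deriv (fun s : ℂ => f (x + t • e + s • v)) 0 = fderiv ℂ f (x + t • e) v := fun t ht => by
    simpa using (hline t ht 0 h0r).deriv
  have hdiff : DifferentiableOn ℂ (fun t : ℂ => fderiv ℂ f (x + t • e) v) (ball 0 r) := by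
    refine TendstoLocallyUniformlyOn.differentiableOn (φ := 𝓝[≠] (0 : ℂ))
      (F := fun s t => dslope (fun s : ℂ => f (x + t • e + s • v)) 0 s) ?_ ?_ isOpen_ball
    · apply TendstoUniformlyOn.tendstoLocallyUniformlyOn
      rw [Metric.tendstoUniformlyOn_iff]
      intro ε hε
      set C := 2 * (2 * (‖f x‖ + 1) / r) / r
      have hC : Tendsto (fun s : ℂ => C * ‖s‖) (𝓝[≠] 0) (𝓝 0) :=
        ((continuous_const.mul continuous_norm).tendsto' 0 0 (by simp)).mono_left
          nhdsWithin_le_nhds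
      filter_upwards [hC.eventually_lt_const hε,
        mem_nhdsWithin_of_mem_nhds (ball_mem_nhds (0 : ℂ) hr)] with s hs1 hs2 t ht
      rw [dist_comm, ← hderiv t ht]
      refine (dist_dslope_deriv_le hr
        (fun s hs => (hline t ht s hs).differentiableAt.differentiableWithinAt)
        (fun s hs => (hball t ht s hs).2) hs2).trans_lt hs1
    · filter_upwards [mem_nhdsWithin_of_mem_nhds (ball_mem_nhds (0 : ℂ) hr),
        self_mem_nhdsWithin] with s hs hne t ht
      have hD : ∀ s ∈ ball (0 : ℂ) r,
          DifferentiableAt ℂ (fun t : ℂ => f (x + t • e + s • v)) t := fun s hs =>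
        (hf.differentiableAt (hW.mem_nhds (hball t ht s hs).1)).comp t (by fun_prop)
      have h0 := hD 0 h0r
      simp only [dslope_of_ne _ hne, slope, vsub_eq_sub, smul_eq_mul]
      exact (((hD s hs).sub h0).const_mul _).differentiableWithinAt
  exact hdiff.analyticAt (ball_mem_nhds 0 hr)

end PartialDeriv

section Wirtinger

open Filter Topology

variable {ι κ μ : Type*}

/-- The Wirtinger derivative `∂/∂t` of a function of one complex variable. -/
def dz (f : ℂ → ℂ) (t : ℂ) : ℂ := (fderiv ℝ f t 1 - I * fderiv ℝ f t I) / 2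

/-- The conjugate Wirtinger derivative `∂/∂t̄` of a function of one complex variable. -/
def dzb (f : ℂ → ℂ) (t : ℂ) : ℂ := (fderiv ℝ f t 1 + I * fderiv ℝ f t I) / 2

theorem Filter.EventuallyEq.dz_eq {f g : ℂ → ℂ} {t : ℂ} (h : f =ᶠ[𝓝 t] g) : dz f t = dz g t := by
  rw [dz, dz, h.fderiv_eq]

theorem Filter.EventuallyEq.dzb_eq {f g : ℂ → ℂ} {t : ℂ} (h : f =ᶠ[𝓝 t] g) :
    dzb f t = dzb g t := by
  rw [dzb, dzb, h.fderiv_eq]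

theorem Filter.EventuallyEq.dzb_eventuallyEq {f g : ℂ → ℂ} {t : ℂ} (h : f =ᶠ[𝓝 t] g) :
    dzb f =ᶠ[𝓝 t] dzb g :=
  h.eventuallyEq_nhds.mono fun _ hs => Filter.EventuallyEq.dzb_eq hs

theorem dz_sum [Fintype ι] {f : ι → ℂ → ℂ} {t : ℂ} (hf : ∀ i, DifferentiableAt ℝ (f i) t) :
    dz (fun s => ∑ i, f i s) t = ∑ i, dz (f i) t := by
  simp only [dz, fderiv_fun_sum fun i (_ : i ∈ Finset.univ) => hf i, _root_.sum_apply,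
    Finset.mul_sum, ← Finset.sum_sub_distrib, Finset.sum_div]

theorem dzb_sum [Fintype ι] {f : ι → ℂ → ℂ} {t : ℂ} (hf : ∀ i, DifferentiableAt ℝ (f i) t) :
    dzb (fun s => ∑ i, f i s) t = ∑ i, dzb (f i) t := by
  simp only [dzb, fderiv_fun_sum fun i (_ : i ∈ Finset.univ) => hf i,
    _root_.sum_apply, Finset.mul_sum, ← Finset.sum_add_distrib, Finset.sum_div]

theorem dz_mul {f g : ℂ → ℂ} {t : ℂ} (hf : DifferentiableAt ℝ f t)
    (hg : DifferentiableAt ℝ g t) :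
    dz (fun s => f s * g s) t = dz f t * g t + f t * dz g t := by
  simp only [dz, fderiv_fun_mul hf hg, _root_.add_apply,
    _root_.smul_apply, smul_eq_mul]
  ring

theorem dzb_mul {f g : ℂ → ℂ} {t : ℂ} (hf : DifferentiableAt ℝ f t)
    (hg : DifferentiableAt ℝ g t) :
    dzb (fun s => f s * g s) t = dzb f t * g t + f t * dzb g t := by
  simp only [dzb, fderiv_fun_mul hf hg, _root_.add_apply,
    _root_.smul_apply, smul_eq_mul]
  ring

theorem fderiv_real_star (f : ℂ → ℂ) (t u : ℂ) :
    fderiv ℝ (fun s => star (f s)) t u = star (fderiv ℝ f t u) := by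
  have := (conjCLE : ℂ ≃L[ℝ] ℂ).comp_fderiv (f := f) (x := t)
  exact congrArg (fun L : ℂ →L[ℝ] ℂ => L u) this

theorem dz_star (f : ℂ → ℂ) (t : ℂ) : dz (fun s => star (f s)) t = star (dzb f t) := by
  simp only [dz, dzb, fderiv_real_star]
  simp [sub_eq_add_neg]

theorem dzb_star (f : ℂ → ℂ) (t : ℂ) : dzb (fun s => star (f s)) t = star (dz f t) := by
  simp only [dz, dzb, fderiv_real_star]
  simp [sub_eq_add_neg]

theorem fderiv_real_of_holomorphic {f : ℂ → ℂ} {t : ℂ} (hf : DifferentiableAt ℂ f t) (u : ℂ) :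
    fderiv ℝ f t u = u * deriv f t := by
  rw [hf.fderiv_restrictScalars ℝ, ContinuousLinearMap.coe_restrictScalars',
    fderiv_eq_smul_deriv, smul_eq_mul]

theorem dz_of_holomorphic {f : ℂ → ℂ} {t : ℂ} (hf : DifferentiableAt ℂ f t) :
    dz f t = deriv f t := by
  rw [dz, fderiv_real_of_holomorphic hf, fderiv_real_of_holomorphic hf]
  linear_combination (-deriv f t / 2) * I_mul_I

theorem dzb_of_holomorphic {f : ℂ → ℂ} {t : ℂ} (hf : DifferentiableAt ℂ f t) :
    dzb f t = 0 := by
  rw [dzb, fderiv_real_of_holomorphic hf, fderiv_real_of_holomorphic hf]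
  linear_combination (deriv f t / 2) * I_mul_I

theorem dzb_log {f : ℂ → ℂ} {t : ℂ} (hf : DifferentiableAt ℝ f t) (h : f t ∈ slitPlane) :
    dzb (fun s => log (f s)) t = (f t)⁻¹ * dzb f t := by
  have h1 : HasFDerivAt (fun s => log (f s))
      ((((1 : ℂ →L[ℂ] ℂ).smulRight (f t)⁻¹).restrictScalars ℝ).comp (fderiv ℝ f t)) t :=
    (((hasStrictDerivAt_log h).hasDerivAt.hasFDerivAt.restrictScalars ℝ).comp t hf.hasFDerivAt)
  simp only [dzb, h1.fderiv, ContinuousLinearMap.comp_apply,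
    ContinuousLinearMap.coe_restrictScalars', ContinuousLinearMap.smulRight_apply,
    one_apply_eq_self, smul_eq_mul]
  ring

theorem ContDiffAt.fderiv_apply_const {E : Type*} [NormedAddCommGroup E] [NormedSpace ℝ E]
    {f : E → ℂ} {t : E} (hf : ContDiffAt ℝ 2 f t) (u : E) :
    DifferentiableAt ℝ (fun s => fderiv ℝ f s u) t :=
  (((hf.fderiv_right (m := 1) (by norm_num)).differentiableAt one_ne_zero).clm_apply
    (differentiableAt_const u))

theorem ContDiffAt.differentiableAt_dzb {f : ℂ → ℂ} {t : ℂ} (hf : ContDiffAt ℝ 2 f t) :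
    DifferentiableAt ℝ (dzb f) t := by
  have h1 := hf.fderiv_apply_const 1
  have h2 := hf.fderiv_apply_const I
  unfold dzb
  fun_prop

/-! ### Matrix-valued functions -/

/-- Entrywise Wirtinger derivative. -/
def mdz (A : ℂ → Matrix ι κ ℂ) (t : ℂ) : Matrix ι κ ℂ :=
  Matrix.of fun i j => dz (fun s => A s i j) t

/-- Entrywise conjugate Wirtinger derivative. -/
def mdzb (A : ℂ → Matrix ι κ ℂ) (t : ℂ) : Matrix ι κ ℂ :=
  Matrix.of fun i j => dzb (fun s => A s i j) t

/-- Entrywise real differentiability. -/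
def MDiff (A : ℂ → Matrix ι κ ℂ) (t : ℂ) : Prop :=
  ∀ i j, DifferentiableAt ℝ (fun s => A s i j) t

theorem MDiff.mul [Fintype κ] {A : ℂ → Matrix ι κ ℂ} {B : ℂ → Matrix κ μ ℂ} {t : ℂ} (hA : MDiff A t)
    (hB : MDiff B t) : MDiff (fun s => A s * B s) t := fun i j => by
  have h1 := fun k => hA i k
  have h2 := fun k => hB k j
  simp only [Matrix.mul_apply]
  fun_prop

theorem MDiff.add {A B : ℂ → Matrix ι κ ℂ} {t : ℂ} (hA : MDiff A t)
    (hB : MDiff B t) : MDiff (fun s => A s + B s) t := fun i j => by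
  have h1 := hA i j
  have h2 := hB i j
  simp only [Matrix.add_apply]
  fun_prop

theorem MDiff.conjTranspose {A : ℂ → Matrix ι κ ℂ} {t : ℂ} (hA : MDiff A t) :
    MDiff (fun s => (A s).conjTranspose) t := fun i j =>
  (conjCLE : ℂ ≃L[ℝ] ℂ).differentiableAt.comp t (hA j i)

theorem MDiff.det [Fintype ι] [DecidableEq ι] {A : ℂ → Matrix ι ι ℂ} {t : ℂ} (hA : MDiff A t) :
    DifferentiableAt ℝ (fun s => (A s).det) t := by
  have h : ∀ i j, DifferentiableAt ℝ (fun s => A s i j) t := hA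
  simp only [Matrix.det_apply']
  fun_prop

theorem MDiff.inv [Fintype ι] [DecidableEq ι] {A : ℂ → Matrix ι ι ℂ} {t : ℂ}
    (hA : MDiff A t) (h0 : (A t).det ≠ 0) :
    MDiff (fun s => (A s)⁻¹) t := fun i j => by
  have hadj : DifferentiableAt ℝ (fun s => (A s).adjugate i j) t := by
    simp only [Matrix.adjugate_apply]
    refine MDiff.det fun k l => ?_
    simp only [Matrix.updateRow_apply]
    split_ifs
    · exact differentiableAt_const _
    · exact hA k l
  simp only [Matrix.inv_def, Ring.inverse_eq_inv', Matrix.smul_apply, smul_eq_mul]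
  exact (hA.det.inv h0).mul hadj

theorem mdz_mul [Fintype κ] {A : ℂ → Matrix ι κ ℂ} {B : ℂ → Matrix κ μ ℂ} {t : ℂ} (hA : MDiff A t)
    (hB : MDiff B t) : mdz (fun s => A s * B s) t = mdz A t * B t + A t * mdz B t := by
  ext i j
  simp only [mdz, Matrix.of_apply, Matrix.mul_apply, Matrix.add_apply, ← Finset.sum_add_distrib]
  refine (dz_sum fun k => (hA i k).mul (hB k j)).trans ?_
  exact Finset.sum_congr rfl fun k _ => dz_mul (hA i k) (hB k j)

theorem mdzb_mul [Fintype κ] {A : ℂ → Matrix ι κ ℂ} {B : ℂ → Matrix κ μ ℂ} {t : ℂ} (hA : MDiff A t)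
    (hB : MDiff B t) : mdzb (fun s => A s * B s) t = mdzb A t * B t + A t * mdzb B t := by
  ext i j
  simp only [mdzb, Matrix.of_apply, Matrix.mul_apply, Matrix.add_apply, ← Finset.sum_add_distrib]
  refine (dzb_sum fun k => (hA i k).mul (hB k j)).trans ?_
  exact Finset.sum_congr rfl fun k _ => dzb_mul (hA i k) (hB k j)

theorem mdz_add {A B : ℂ → Matrix ι κ ℂ} {t : ℂ} (hA : MDiff A t)
    (hB : MDiff B t) : mdz (fun s => A s + B s) t = mdz A t + mdz B t := by
  ext i j
  simp only [mdz, dz, Matrix.of_apply, Matrix.add_apply, fderiv_fun_add (hA i j) (hB i j),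
    _root_.add_apply]
  ring

theorem mdz_conjTranspose (A : ℂ → Matrix ι κ ℂ) (t : ℂ) :
    mdz (fun s => (A s).conjTranspose) t = (mdzb A t).conjTranspose := by
  ext i j
  exact dz_star _ t

theorem mdzb_conjTranspose (A : ℂ → Matrix ι κ ℂ) (t : ℂ) :
    mdzb (fun s => (A s).conjTranspose) t = (mdz A t).conjTranspose := by
  ext i j
  exact dzb_star _ t

theorem Filter.EventuallyEq.mdz_eq {A B : ℂ → Matrix ι κ ℂ} {t : ℂ} (h : A =ᶠ[𝓝 t] B) :
    mdz A t = mdz B t := by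
  ext i j
  exact Filter.EventuallyEq.dz_eq (h.mono fun s hs => congrFun (congrFun hs i) j)

theorem Filter.EventuallyEq.mdzb_eq {A B : ℂ → Matrix ι κ ℂ} {t : ℂ} (h : A =ᶠ[𝓝 t] B) :
    mdzb A t = mdzb B t := by
  ext i j
  exact Filter.EventuallyEq.dzb_eq (h.mono fun s hs => congrFun (congrFun hs i) j)

theorem mdz_trace [Fintype ι] {A : ℂ → Matrix ι ι ℂ} {t : ℂ} (hA : MDiff A t) :
    dz (fun s => (A s).trace) t = (mdz A t).trace :=
  dz_sum fun i => hA i i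

theorem mdz_inv [Fintype ι] [DecidableEq ι] {A : ℂ → Matrix ι ι ℂ} {t : ℂ}
    (hA : MDiff A t) (h0 : (A t).det ≠ 0) :
    mdz (fun s => (A s)⁻¹) t = -((A t)⁻¹ * mdz A t * (A t)⁻¹) := by
  have hev : ∀ᶠ s in 𝓝 t, (A s).det ≠ 0 := hA.det.continuousAt.eventually_ne h0
  have h1 : (fun s => (A s)⁻¹ * A s) =ᶠ[𝓝 t] fun _ => 1 :=
    hev.mono fun s hs => Matrix.nonsing_inv_mul _ hs.isUnit
  have h2 := h1.mdz_eq
  rw [mdz_mul (hA.inv h0) hA] at h2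
  have h3 : mdz (fun _ => (1 : Matrix ι ι ℂ)) t = 0 := by
    ext i j; simp [mdz, dz]
  rw [h3] at h2
  calc mdz (fun s => (A s)⁻¹) t = mdz (fun s => (A s)⁻¹) t * (A t * (A t)⁻¹) := by
        rw [Matrix.mul_nonsing_inv _ h0.isUnit, Matrix.mul_one]
    _ = (mdz (fun s => (A s)⁻¹) t * A t + (A t)⁻¹ * mdz A t) * (A t)⁻¹ -
        (A t)⁻¹ * mdz A t * (A t)⁻¹ := by
        rw [Matrix.add_mul, ← Matrix.mul_assoc]; abel
    _ = _ := by rw [h2, Matrix.zero_mul, zero_sub]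

/-- Jacobi's formula. -/
theorem fderiv_det [Fintype ι] [DecidableEq ι] {A : ℂ → Matrix ι ι ℂ} {t : ℂ}
    (hA : MDiff A t) (u : ℂ) :
    fderiv ℝ (fun s => (A s).det) t u =
      ((A t).adjugate * Matrix.of fun i j => fderiv ℝ (fun s => A s i j) t u).trace := by
  let D : ContinuousMultilinearMap ℝ (fun _ : ι => ι → ℂ) ℂ :=
    { ((Matrix.detRowAlternating (R := ℂ) (n := ι)).toMultilinearMap.restrictScalars ℝ) with
      cont := Continuous.matrix_det continuous_id }
  have hrow : ∀ i, HasFDerivAt (fun s => A s i)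
      (ContinuousLinearMap.pi fun j => fderiv ℝ (fun s => A s i j) t) t := fun i =>
    hasFDerivAt_pi.2 fun j => (hA i j).hasFDerivAt
  have h := (HasFDerivAt.multilinear_comp D hrow).fderiv
  change fderiv ℝ (fun s => D fun i => A s i) t u = _
  rw [h]
  rw [Matrix.trace_mul_comm]
  simp only [_root_.sum_apply, Matrix.trace, Matrix.diag]
  refine Finset.sum_congr rfl fun i _ => ?_
  change ((A t).updateRow i fun j => fderiv ℝ (fun s => A s i j) t u).det = _
  rw [← Matrix.cramer_transpose_apply, Matrix.cramer_eq_adjugate_mulVec,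
    ← Matrix.adjugate_transpose, Matrix.mulVec_transpose, Matrix.vecMul, Matrix.mul_apply]
  rfl

theorem dzb_det [Fintype ι] [DecidableEq ι] {A : ℂ → Matrix ι ι ℂ} {t : ℂ}
    (hA : MDiff A t) (h0 : (A t).det ≠ 0) :
    dzb (fun s => (A s).det) t = (A t).det * ((A t)⁻¹ * mdzb A t).trace := by
  have hm : mdzb A t = (1 / 2 : ℂ) • ((Matrix.of fun i j => fderiv ℝ (fun s => A s i j) t 1) +
      I • Matrix.of fun i j => fderiv ℝ (fun s => A s i j) t I) := by
    ext i j
    simp [mdzb, dzb]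
    ring
  have hadj : (A t).adjugate = (A t).det • (A t)⁻¹ := by
    rw [Matrix.inv_def, smul_smul, Ring.inverse_eq_inv', mul_inv_cancel₀ h0, one_smul]
  rw [dzb, fderiv_det hA, fderiv_det hA, hm, hadj]
  simp only [Matrix.smul_mul, Matrix.mul_smul, Matrix.mul_add, Matrix.trace_smul,
    Matrix.trace_add, smul_eq_mul]
  ring

end Wirtinger

section Schur

variable {ι κ : Type*} [Fintype ι] [Fintype κ]

theorem re_dotProduct_mulVec_star_nonneg {S : Matrix ι ι ℂ} (hS : S.PosSemidef) (v : ι → ℂ) :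
    0 ≤ (v ⬝ᵥ S.mulVec (star v)).re := by
  have := hS.re_dotProduct_nonneg (star v)
  rwa [star_star] at this

theorem dotProduct_mul_mul_conjTranspose (M : Matrix ι κ ℂ) (Z : Matrix κ κ ℂ) (v : ι → ℂ) :
    v ⬝ᵥ (M * Z * M.conjTranspose).mulVec (star v) =
      (Matrix.vecMul v M) ⬝ᵥ Z.mulVec (star (Matrix.vecMul v M)) := by
  rw [Matrix.star_vecMul, Matrix.dotProduct_mulVec, ← Matrix.vecMul_vecMul, ← Matrix.vecMul_vecMul,
    ← Matrix.dotProduct_mulVec, ← Matrix.dotProduct_mulVec]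

theorem re_trace_mul_nonneg {R S : Matrix ι ι ℂ} (hR : R.PosSemidef)
    (hS : ∀ v : ι → ℂ, 0 ≤ (v ⬝ᵥ S.mulVec (star v)).re) : 0 ≤ (R * S).trace.re := by
  obtain ⟨B, rfl⟩ := exists_eq_conjTranspose_mul_self hR
  have : (B.conjTranspose * B * S).trace = ∑ i, B i ⬝ᵥ S.mulVec (star (B i)) := by
    rw [Matrix.trace_mul_comm, ← Matrix.mul_assoc, Matrix.trace_mul_comm, ← Matrix.mul_assoc]
    refine Finset.sum_congr rfl fun i _ => ?_
    rw [Matrix.mul_assoc]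
    rfl
  rw [this, Complex.re_sum]
  exact Finset.sum_nonneg fun i _ => hS _

variable [DecidableEq κ]

theorem second_variation_eq {H : Matrix κ κ ℂ} (hH : H.PosDef) (dH ddH : Matrix κ κ ℂ)
    (M K : Matrix ι κ ℂ) (R : Matrix ι ι ℂ) :
    K * dH.conjTranspose * M.conjTranspose + K * H * K.conjTranspose +
        (M * ddH * M.conjTranspose + M * dH * K.conjTranspose) -
        (K * H + M * dH) * M.conjTranspose * R * (M * (K * H + M * dH).conjTranspose) =
      (K * H + M * dH) * (H⁻¹ - M.conjTranspose * R * M) * (K * H + M * dH).conjTranspose +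
        M * (ddH - dH * H⁻¹ * dH.conjTranspose) * M.conjTranspose := by
  have hHu : IsUnit H.det := hH.det_pos.ne'.isUnit
  simp only [Matrix.conjTranspose_add, Matrix.conjTranspose_mul, hH.isHermitian.eq,
    Matrix.mul_sub, Matrix.sub_mul, Matrix.mul_add, Matrix.add_mul, Matrix.mul_assoc,
    Matrix.mul_nonsing_inv_cancel_left _ _ hHu, Matrix.nonsing_inv_mul_cancel_left _ _ hHu]
  abel

open Filter Topology

variable [DecidableEq ι]

/-- The inverse of a positive definite matrix dominates the inverse of its compressions. -/
theorem posSemidef_inv_sub {H : Matrix κ κ ℂ} (hH : H.PosDef) (M : Matrix ι κ ℂ)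
    (hdet : (M * H * M.conjTranspose).det ≠ 0) :
    (H⁻¹ - M.conjTranspose * (M * H * M.conjTranspose)⁻¹ * M).PosSemidef := by
  set A := M * H * M.conjTranspose with hA
  set Q := M.conjTranspose * A⁻¹ * M with hQ
  have hAh : A⁻¹.IsHermitian :=
    (Matrix.isHermitian_mul_mul_conjTranspose _ hH.isHermitian).inv
  have hP : (H⁻¹ - Q).IsHermitian :=
    hH.isHermitian.inv.sub (Matrix.isHermitian_conjTranspose_mul_mul _ hAh)
  have hHu : IsUnit H.det := hH.det_pos.ne'.isUnit
  have hQHQ : Q * H * Q = Q := by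
    calc Q * H * Q = M.conjTranspose * A⁻¹ * (M * H * M.conjTranspose) * A⁻¹ * M := by
          simp only [hQ, Matrix.mul_assoc]
      _ = Q := by rw [← hA, Matrix.mul_assoc _ A⁻¹ A, Matrix.nonsing_inv_mul _ hdet.isUnit,
          Matrix.mul_one]
  have key : H⁻¹ - Q = (H⁻¹ - Q) * H * (H⁻¹ - Q).conjTranspose := by
    rw [hP.eq, Matrix.sub_mul, Matrix.nonsing_inv_mul _ hHu, Matrix.sub_mul, Matrix.one_mul,
      Matrix.mul_sub, hQHQ, Matrix.mul_assoc, Matrix.mul_nonsing_inv _ hHu, Matrix.mul_one]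
    abel
  rw [key]
  exact hH.posSemidef.mul_mul_conjTranspose_same _

/-- The logarithm of the determinant of the metric induced on a holomorphic subbundle of a
Griffiths semi-negative bundle is subharmonic. -/
theorem re_dz_dzb_log_det_nonneg {H : ℂ → Matrix κ κ ℂ} {M : ℂ → Matrix ι κ ℂ}
    (hH : ∀ i j, ContDiffAt ℝ 2 (fun t => H t i j) 0)
    (hHp : ∀ᶠ t in 𝓝 0, (H t).PosDef)
    (hM : ∀ i j, AnalyticAt ℂ (fun t => M t i j) 0)
    (hneg : ∀ v : κ → ℂ,
      0 ≤ (v ⬝ᵥ (mdz (mdzb H) 0 - mdz H 0 * (H 0)⁻¹ * mdzb H 0).mulVec (star v)).re)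
    (hdet : (M 0 * H 0 * (M 0).conjTranspose).det ≠ 0) :
    0 ≤ (dz (dzb fun t => log (M t * H t * (M t).conjTranspose).det) 0).re := by
  set A : ℂ → Matrix ι ι ℂ := fun t => M t * H t * (M t).conjTranspose with hAdef
  set K : ℂ → Matrix ι κ ℂ := mdz M with hKdef
  have hMan : ∀ᶠ t in 𝓝 (0 : ℂ), ∀ i j, AnalyticAt ℂ (fun t => M t i j) t :=
    eventually_all.2 fun i => eventually_all.2 fun j => (hM i j).eventually_analyticAt
  have hMd : ∀ᶠ t in 𝓝 (0 : ℂ), MDiff M t := hMan.mono fun t ht i j =>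
    (ht i j).differentiableAt.restrictScalars ℝ
  have hMb : ∀ᶠ t in 𝓝 (0 : ℂ), mdzb M t = 0 := hMan.mono fun t ht => by
    ext i j
    exact dzb_of_holomorphic (ht i j).differentiableAt
  have hKev : ∀ i j, (fun t => K t i j) =ᶠ[𝓝 0] deriv fun t => M t i j := fun i j =>
    hMan.mono fun t ht => dz_of_holomorphic (ht i j).differentiableAt
  have hKan : ∀ i j, AnalyticAt ℂ (fun t => K t i j) 0 := fun i j =>
    (hM i j).deriv.congr (hKev i j).symm
  have hKd : MDiff K 0 := fun i j => (hKan i j).differentiableAt.restrictScalars ℝ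
  have hKb : mdzb K 0 = 0 := by
    ext i j
    exact dzb_of_holomorphic (hKan i j).differentiableAt
  have hHd : ∀ᶠ t in 𝓝 (0 : ℂ), MDiff H t :=
    eventually_all.2 fun i => eventually_all.2 fun j =>
      ((hH i j).eventually (by simp)).mono fun t ht => ht.differentiableAt (by norm_num)
  have hHbd : MDiff (mdzb H) 0 := fun i j => (hH i j).differentiableAt_dzb
  have hAd : ∀ᶠ t in 𝓝 (0 : ℂ), MDiff A t := (hMd.and hHd).mono fun t ht =>
    (ht.1.mul ht.2).mul ht.1.conjTranspose
  have hHH : mdzb H 0 = (mdz H 0).conjTranspose := by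
    rw [← mdzb_conjTranspose]
    exact Filter.EventuallyEq.mdzb_eq (hHp.mono fun t ht => ht.isHermitian.eq.symm)
  have hAb : mdzb A =ᶠ[𝓝 0] fun t =>
      M t * mdzb H t * (M t).conjTranspose + M t * H t * (K t).conjTranspose := by
    filter_upwards [hMd, hHd, hMb] with t hM hH hMb
    rw [hAdef, mdzb_mul (hM.mul hH) hM.conjTranspose, mdzb_mul hM hH, hMb, mdzb_conjTranspose,
      Matrix.zero_mul, zero_add]
  have hM0 := hMd.self_of_nhds
  have hH0 := hHd.self_of_nhds
  have hA0 := hAd.self_of_nhds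
  have hMb0 := hMb.self_of_nhds
  have hAbd : MDiff (mdzb A) 0 := fun i j =>
    (((hM0.mul hHbd).mul hM0.conjTranspose).add ((hM0.mul hH0).mul hKd.conjTranspose)
      i j).congr_of_eventuallyEq (hAb.mono fun t ht => congrFun (congrFun ht i) j)
  have hdA : mdz A 0 = (K 0 * H 0 + M 0 * mdz H 0) * (M 0).conjTranspose := by
    rw [hAdef, mdz_mul (hM0.mul hH0) hM0.conjTranspose, mdz_mul hM0 hH0, mdz_conjTranspose, hMb0]
    simp [hKdef]
  have hdbA : mdzb A 0 = M 0 * (K 0 * H 0 + M 0 * mdz H 0).conjTranspose := by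
    refine hAb.self_of_nhds.trans ?_
    beta_reduce
    rw [hHH]
    simp only [Matrix.conjTranspose_add, Matrix.conjTranspose_mul,
      hHp.self_of_nhds.isHermitian.eq, Matrix.mul_add, Matrix.mul_assoc]
    abel
  have hddA : mdz (mdzb A) 0 = K 0 * (mdz H 0).conjTranspose * (M 0).conjTranspose +
      K 0 * H 0 * (K 0).conjTranspose + (M 0 * mdz (mdzb H) 0 * (M 0).conjTranspose +
      M 0 * mdz H 0 * (K 0).conjTranspose) := by
    rw [hAb.mdz_eq, mdz_add ((hM0.mul hHbd).mul hM0.conjTranspose)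
        ((hM0.mul hH0).mul hKd.conjTranspose),
      mdz_mul (hM0.mul hHbd) hM0.conjTranspose, mdz_mul hM0 hHbd,
      mdz_mul (hM0.mul hH0) hKd.conjTranspose, mdz_mul hM0 hH0, mdz_conjTranspose,
      mdz_conjTranspose, hMb0, hKb, hHH]
    simp only [Matrix.conjTranspose_zero, Matrix.mul_zero, Matrix.add_mul, hKdef]
    abel
  have hApsd : ∀ᶠ t in 𝓝 (0 : ℂ), (A t).PosSemidef := hHp.mono fun t ht =>
    ht.posSemidef.mul_mul_conjTranspose_same _
  have hAdet : ∀ᶠ t in 𝓝 (0 : ℂ), (A t).det ≠ 0 := hA0.det.continuousAt.eventually_ne hdet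
  have hlog : (dzb fun t => log (A t).det) =ᶠ[𝓝 0] fun t => ((A t)⁻¹ * mdzb A t).trace := by
    filter_upwards [hApsd, hAdet, hAd] with t hp h0 hd
    have hpos : 0 < (A t).det := lt_of_le_of_ne hp.det_nonneg h0.symm
    rw [dzb_log hd.det (Complex.mem_slitPlane_iff.2 (Or.inl (Complex.pos_iff.1 hpos).1)),
      dzb_det hd h0, inv_mul_cancel_left₀ h0]
  rw [hlog.dz_eq, mdz_trace ((hA0.inv hdet).mul hAbd), mdz_mul (hA0.inv hdet) hAbd,
    mdz_inv hA0 hdet]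
  have hfac : -((A 0)⁻¹ * mdz A 0 * (A 0)⁻¹) * mdzb A 0 + (A 0)⁻¹ * mdz (mdzb A) 0 =
      (A 0)⁻¹ * (mdz (mdzb A) 0 - mdz A 0 * (A 0)⁻¹ * mdzb A 0) := by
    simp only [Matrix.mul_sub, Matrix.neg_mul, Matrix.mul_assoc]
    abel
  rw [hfac]
  refine re_trace_mul_nonneg hApsd.self_of_nhds.inv fun v => ?_
  have hHp0 := hHp.self_of_nhds
  rw [hddA, hdA, hdbA, second_variation_eq hHp0, Matrix.add_mulVec, dotProduct_add,
    Complex.add_re, dotProduct_mul_mul_conjTranspose (M 0), ← hHH]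
  exact add_nonneg (re_dotProduct_mulVec_star_nonneg
    ((posSemidef_inv_sub hHp0 (M 0) hdet).mul_mul_conjTranspose_same _) v) (hneg _)

end Schur

section Chain

open Filter Topology

variable {ι : Type*} [Fintype ι]

theorem sum_contract (D E : ι → ι → ℂ) (Y : ι → ι → ℂ) (ξ η : ι → ℂ) :
    ∑ p, (∑ q, (∑ k, D k q * ξ k) * Y q p) * ∑ l, E l p * η l =
      ∑ k, ∑ l, (∑ p, ∑ q, Y q p * D k q * E l p) * ξ k * η l := by
  calc _ = ∑ p, ∑ l, ∑ q, ∑ k, Y q p * D k q * E l p * ξ k * η l := by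
        simp only [Finset.sum_mul, Finset.mul_sum]
        refine Finset.sum_congr rfl fun p _ => Finset.sum_congr rfl fun l _ =>
          Finset.sum_congr rfl fun q _ => Finset.sum_congr rfl fun k _ => ?_
        ring
    _ = ∑ p, ∑ k, ∑ l, ∑ q, Y q p * D k q * E l p * ξ k * η l :=
        Finset.sum_congr rfl fun p _ =>
          (Finset.sum_congr rfl fun l _ => Finset.sum_comm).trans Finset.sum_comm
    _ = ∑ k, ∑ l, ∑ p, ∑ q, Y q p * D k q * E l p * ξ k * η l :=
        Finset.sum_comm.trans (Finset.sum_congr rfl fun k _ => Finset.sum_comm)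
    _ = _ := by simp only [Finset.sum_mul]

theorem clm_apply_eq_sum [DecidableEq ι] (L : (ι → ℂ) →L[ℝ] ℂ) (v : ι → ℂ) :
    L v = ∑ k, ((v k).re * L (Pi.single k 1) + (v k).im * L (Pi.single k I)) := by
  have h : v = ∑ k, ((v k).re • (Pi.single k 1 : ι → ℂ) + (v k).im • (Pi.single k I : ι → ℂ)) := by
    ext j
    simp [Finset.sum_apply, Pi.single_apply, Complex.re_add_im, Finset.sum_add_distrib]
  conv_lhs => rw [h]
  simp only [map_sum, map_add, map_smul, Complex.real_smul]

theorem fderiv_comp_curve {f : (ι → ℂ) → ℂ} {a : ℂ → ι → ℂ} {a' : ι → ℂ} {t : ℂ}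
    (hf : DifferentiableAt ℝ f (a t)) (ha : HasDerivAt a a' t) (u : ℂ) :
    fderiv ℝ (fun s => f (a s)) t u = fderiv ℝ f (a t) (u • a') := by
  have h := hf.hasFDerivAt.comp t (ha.hasFDerivAt.restrictScalars ℝ)
  have h' : fderiv ℝ (fun s => f (a s)) t = _ := h.fderiv
  rw [h']
  simp

variable [DecidableEq ι]

/-- Chain rule for `∂/∂t` along a holomorphic curve. -/
theorem dz_comp_curve {f : (ι → ℂ) → ℂ} {a : ℂ → ι → ℂ} {a' : ι → ℂ} {t : ℂ}
    (hf : DifferentiableAt ℝ f (a t)) (ha : HasDerivAt a a' t) :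
    dz (fun s => f (a s)) t = ∑ k, wdz k f (a t) * a' k := by
  simp only [dz, fderiv_comp_curve hf ha]
  rw [clm_apply_eq_sum _ ((1 : ℂ) • a'), clm_apply_eq_sum _ (I • a'), Finset.mul_sum,
    ← Finset.sum_sub_distrib, Finset.sum_div]
  refine Finset.sum_congr rfl fun k _ => ?_
  conv_rhs => rw [← Complex.re_add_im (a' k)]
  simp only [wdz, Pi.smul_apply, smul_eq_mul, Complex.mul_re, Complex.mul_im,
    Complex.I_re, Complex.I_im, zero_mul, one_mul, zero_sub, zero_add,
    Complex.ofReal_neg]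
  linear_combination (-(a' k).im * fderiv ℝ f (a t) (Pi.single k I) / 2) * (-I_sq)

/-- Chain rule for `∂/∂t̄` along a holomorphic curve. -/
theorem dzb_comp_curve {f : (ι → ℂ) → ℂ} {a : ℂ → ι → ℂ} {a' : ι → ℂ} {t : ℂ}
    (hf : DifferentiableAt ℝ f (a t)) (ha : HasDerivAt a a' t) :
    dzb (fun s => f (a s)) t = ∑ k, wdzbar k f (a t) * star (a' k) := by
  simp only [dzb, fderiv_comp_curve hf ha]
  rw [clm_apply_eq_sum _ ((1 : ℂ) • a'), clm_apply_eq_sum _ (I • a'), Finset.mul_sum,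
    ← Finset.sum_add_distrib, Finset.sum_div]
  refine Finset.sum_congr rfl fun k _ => ?_
  have : star (a' k) = (a' k).re - (a' k).im * I := by
    apply Complex.ext <;> simp
  rw [this]
  simp only [wdzbar, Pi.smul_apply, smul_eq_mul, Complex.mul_re, Complex.mul_im,
    Complex.I_re, Complex.I_im, zero_mul, one_mul, zero_sub, zero_add,
    Complex.ofReal_neg]
  linear_combination ((a' k).im * fderiv ℝ f (a t) (Pi.single k I) / 2) * I_sq

theorem ContDiffAt.differentiableAt_wdzbar {f : (ι → ℂ) → ℂ} {z : ι → ℂ}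
    (hf : ContDiffAt ℝ 2 f z) (l : ι) : DifferentiableAt ℝ (wdzbar l f) z := by
  have h1 := hf.fderiv_apply_const (Pi.single l 1)
  have h2 := hf.fderiv_apply_const (Pi.single l I)
  unfold wdzbar
  fun_prop

/-- The complex Hessian of `f` along a holomorphic curve. -/
theorem dz_dzb_comp_curve {f : (ι → ℂ) → ℂ} {a : ℂ → ι → ℂ}
    (hf : ContDiffAt ℝ 2 f (a 0)) (ha : AnalyticAt ℂ a 0) :
    dz (dzb fun s => f (a s)) 0 =
      ∑ k, ∑ l, wdz k (wdzbar l f) (a 0) * deriv a 0 k * star (deriv a 0 l) := by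
  have hev : dzb (fun s => f (a s)) =ᶠ[𝓝 0]
      fun s => ∑ l, wdzbar l f (a s) * star (deriv a s l) := by
    filter_upwards [ha.continuousAt.eventually (hf.eventually (by simp)),
      ha.eventually_analyticAt] with s h1 h2
    exact dzb_comp_curve (h1.differentiableAt two_ne_zero) h2.differentiableAt.hasDerivAt
  have hd : ∀ l, DifferentiableAt ℂ (fun s => deriv a s l) 0 := fun l =>
    differentiableAt_pi.1 ha.deriv.differentiableAt l
  have hs : ∀ l, DifferentiableAt ℝ (fun s => star (deriv a s l)) 0 := fun l =>
    (conjCLE : ℂ ≃L[ℝ] ℂ).differentiableAt.comp (0 : ℂ) ((hd l).restrictScalars ℝ)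
  have hw : ∀ l, DifferentiableAt ℝ (fun s => wdzbar l f (a s)) 0 := fun l =>
    (hf.differentiableAt_wdzbar l).comp (0 : ℂ) (ha.differentiableAt.restrictScalars ℝ)
  rw [hev.dz_eq, dz_sum fun l => (hw l).fun_mul (hs l), Finset.sum_comm]
  refine Finset.sum_congr rfl fun l _ => ?_
  rw [dz_mul (hw l) (hs l), dz_star, dzb_of_holomorphic (hd l),
    dz_comp_curve (hf.differentiableAt_wdzbar l) ha.differentiableAt.hasDerivAt, star_zero,
    mul_zero, add_zero, Finset.sum_mul]

/-- The curvature of the restriction of a metric to a curve is a bisectional curvature. -/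
theorem dotProduct_curvature_comp_curve {g : (ι → ℂ) → Matrix ι ι ℂ} {a : ℂ → ι → ℂ}
    (hg : ∀ i j, ContDiffAt ℝ 2 (fun z => g z i j) (a 0)) (ha : AnalyticAt ℂ a 0) (v : ι → ℂ) :
    v ⬝ᵥ (mdz (mdzb fun t => g (a t)) 0 -
        mdz (fun t => g (a t)) 0 * (g (a 0))⁻¹ * mdzb (fun t => g (a t)) 0).mulVec (star v) =
      -bisect g (a 0) v (deriv a 0) := by
  set ξ := deriv a 0 with hξ
  have hent : ∀ i j, (mdz (mdzb fun t => g (a t)) 0 -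
      mdz (fun t => g (a t)) 0 * (g (a 0))⁻¹ * mdzb (fun t => g (a t)) 0) i j =
      -∑ k, ∑ l, chernCurv g (a 0) i j k l * ξ k * star (ξ l) := by
    intro i j
    have h1 : ∀ i q, dz (fun s => g (a s) i q) 0 =
        ∑ k, wdz k (fun w => g w i q) (a 0) * ξ k := fun i q =>
      dz_comp_curve ((hg i q).differentiableAt two_ne_zero) ha.differentiableAt.hasDerivAt
    have h2 : ∀ p j, dzb (fun s => g (a s) p j) 0 =
        ∑ l, wdzbar l (fun w => g w p j) (a 0) * star (ξ l) := fun p j =>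
      dzb_comp_curve ((hg p j).differentiableAt two_ne_zero) ha.differentiableAt.hasDerivAt
    have h3 : dz (dzb fun s => g (a s) i j) 0 =
        ∑ k, ∑ l, wdz k (wdzbar l fun w => g w i j) (a 0) * ξ k * star (ξ l) :=
      dz_dzb_comp_curve (f := fun z => g z i j) (hg i j) ha
    have h3' : mdz (mdzb fun t => g (a t)) 0 i j = dz (dzb fun s => g (a s) i j) 0 := rfl
    have h4 : (mdz (fun t => g (a t)) 0 * (g (a 0))⁻¹ * mdzb (fun t => g (a t)) 0) i j =
        ∑ k, ∑ l, (∑ p, ∑ q, (g (a 0))⁻¹ q p * wdz k (fun w => g w i q) (a 0) *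
          wdzbar l (fun w => g w p j) (a 0)) * ξ k * star (ξ l) := by
      simp only [Matrix.mul_apply, mdz, mdzb, Matrix.of_apply, h1, h2]
      exact sum_contract (fun k q => wdz k (fun w => g w i q) (a 0))
        (fun l p => wdzbar l (fun w => g w p j) (a 0))
        (fun q p => (g (a 0))⁻¹ q p) ξ fun l => star (ξ l)
    rw [Matrix.sub_apply, h3', h3, h4]
    simp only [← Finset.sum_neg_distrib, ← Finset.sum_sub_distrib]
    refine Finset.sum_congr rfl fun k _ => Finset.sum_congr rfl fun l _ => ?_
    rw [chernCurv]
    change _ = -((-(wdz k (wdzbar l fun w => g w i j) (a 0)) + _) * _ * _)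
    ring
  simp only [dotProduct, Matrix.mulVec, bisect, ← Finset.sum_neg_distrib]
  refine Finset.sum_congr rfl fun i _ => ?_
  rw [Finset.mul_sum]
  refine Finset.sum_congr rfl fun j _ => ?_
  rw [hent, neg_mul, mul_neg, Finset.sum_mul, Finset.mul_sum, ← Finset.sum_neg_distrib]
  refine Finset.sum_congr rfl fun k _ => ?_
  rw [Finset.sum_mul, Finset.mul_sum, ← Finset.sum_neg_distrib]
  refine Finset.sum_congr rfl fun l _ => ?_
  simp only [starRingEnd_apply, Pi.star_apply]
  ring

end Chain

section Assembly

open Filter Topology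

/-- Proportional minors force proportional determinants. -/
theorem exists_det_eq_mul {m p : ℕ} (hp : 1 ≤ p) (hpm : p ≤ m) {lam : ℝ} (hlam : 0 < lam) :
    ∃ c : ℝ, 0 < c ∧ ∀ A G : Matrix (Fin m) (Fin m) ℂ, A.PosSemidef → G.PosDef →
      (∀ L K : Fin p → Fin m, StrictMono L → StrictMono K →
        (A.submatrix L K).det = (lam : ℂ) * (G.submatrix L K).det) →
      A.det = (c : ℂ) * G.det := by
  have hp0 : p ≠ 0 := by omega
  refine ⟨(lam ^ m) ^ ((p : ℝ)⁻¹), by positivity, fun A G hA hG h => ?_⟩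
  have key := det_pow_eq_of_minors (by omega) hpm hA.isHermitian hG h
  obtain ⟨a, ha, hAa⟩ : ∃ a : ℝ, 0 ≤ a ∧ A.det = a :=
    ⟨A.det.re, (Complex.nonneg_iff.1 hA.det_nonneg).1,
      Complex.ext rfl (Complex.nonneg_iff.1 hA.det_nonneg).2.symm⟩
  obtain ⟨b, hb, hGb⟩ : ∃ b : ℝ, 0 < b ∧ G.det = b :=
    ⟨G.det.re, (Complex.pos_iff.1 hG.det_pos).1,
      Complex.ext rfl (Complex.pos_iff.1 hG.det_pos).2.symm⟩
  rw [hAa, hGb] at key ⊢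
  have key' : a ^ p = lam ^ m * b ^ p := by exact_mod_cast key
  have : a = (lam ^ m) ^ ((p : ℝ)⁻¹) * b := by
    refine (pow_left_inj₀ ha (by positivity) hp0).1 ?_
    rw [key', mul_pow, Real.rpow_inv_natCast_pow (by positivity) hp0]
  rw [this, Complex.ofReal_mul]

theorem pullbackMetric_eq {m : ℕ} {ι : Type*} [Fintype ι]
    (gN : (ι → ℂ) → Matrix ι ι ℂ) (F : (Fin m → ℂ) → ι → ℂ) (w : Fin m → ℂ) :
    pullbackMetric gN F w = (Matrix.of fun l i => Jac F w i l) * gN (F w) *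
      (Matrix.of fun l i => Jac F w i l).conjTranspose := by
  ext l k
  simp only [pullbackMetric, Matrix.of_apply, Matrix.mul_apply, Matrix.conjTranspose_apply,
    Finset.sum_mul]
  rw [Finset.sum_comm]
  refine Finset.sum_congr rfl fun i _ => Finset.sum_congr rfl fun j _ => ?_
  rw [starRingEnd_apply]
  ring

theorem contDiffAt_log_det {m : ℕ} {U : Set (Fin m → ℂ)} (hU : IsOpen U) (g : HermMetricOn U)
    {x : Fin m → ℂ} (hx : x ∈ U) : ContDiffAt ℝ 2 (fun z => log (g.g z).det) x := by
  have hs : ∀ i j, ContDiffAt ℝ 2 (fun z => g.g z i j) x := fun i j =>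
    ((g.smooth i j).contDiffAt (hU.mem_nhds hx)).of_le
      (WithTop.coe_le_coe.2 (le_top : (2 : ℕ∞) ≤ ⊤))
  have hd : ContDiffAt ℝ 2 (fun z => (g.g z).det) x := by
    simp only [Matrix.det_apply']
    exact ContDiffAt.sum fun σ _ => contDiffAt_const.mul (contDiffAt_prod fun i _ => hs _ _)
  have hpos : (g.g x).det ∈ slitPlane := Or.inl (Complex.pos_iff.1 (g.posDef x hx).det_pos).1
  exact ((Complex.contDiffAt_log hpos).restrict_scalars ℝ).comp x hd

theorem dz_dzb_const_add (f : ℂ → ℂ) (c : ℂ) (t : ℂ) :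
    dz (dzb fun s => c + f s) t = dz (dzb f) t := by
  unfold dzb
  simp only [fderiv_const_add]

end Assembly

/-!
STATEMENT 15: if `(K_M^*, det g_M)` is positive and `(N, ω_N)` has semi-negative holomorphic
bisectional curvature, then there is no germ of holomorphic map `F : (M; x₀) → (N; F(x₀))`
with `F^*ω_N^p = λ ω_M^p` (λ > 0, 1 ≤ p ≤ min{m,n}).
-/
theorem stmt15 {m n : ℕ} (U : Set (Fin m → ℂ)) (hU : IsOpen U)
    (V : Set (Fin n → ℂ)) (hV : IsOpen V)
    (gM : HermMetricOn U) (gN : HermMetricOn V)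
    (hKM : AnticanonicalPositive U gM.g)
    (hNeg : SemiNegBisectional V gN.g)
    (x₀ : Fin m → ℂ) (hx₀ : x₀ ∈ U)
    (p : ℕ) (hp : 1 ≤ p) (hpm : p ≤ m) (hpn : p ≤ n)
    (lam : ℝ) (hlam : 0 < lam) :
    ¬ ∃ (W : Set (Fin m → ℂ)) (F : (Fin m → ℂ) → Fin n → ℂ),
        IsOpen W ∧ x₀ ∈ W ∧ W ⊆ U ∧ DifferentiableOn ℂ F W ∧ Set.MapsTo F W V ∧
        PreservesPP gM.g gN.g F W p lam := by
  rintro ⟨W, F, hW, hx₀W, hWU, hF, hFV, hpres⟩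
  let k : Fin m := ⟨0, by omega⟩
  set e : Fin m → ℂ := Pi.single k 1 with he
  obtain ⟨c, hc, hdet⟩ := exists_det_eq_mul hp hpm hlam
  have hFi : ∀ i, DifferentiableOn ℂ (fun w => F w i) W := fun i =>
    (differentiableOn_pi.1 hF) i
  have hline : AnalyticAt ℂ (fun t : ℂ => x₀ + t • e) 0 := by fun_prop
  have hline0 : x₀ + (0 : ℂ) • e = x₀ := by simp
  have hcont : ContinuousAt (fun t : ℂ => x₀ + t • e) 0 := hline.continuousAt
  have hev : ∀ᶠ t : ℂ in nhds 0, x₀ + t • e ∈ W :=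
    hcont.eventually_mem (by rw [hline0]; exact hW.mem_nhds hx₀W)
  have hcurve : AnalyticAt ℂ (fun t : ℂ => F (x₀ + t • e)) 0 := by
    rw [Complex.analyticAt_iff_eventually_differentiableAt]
    filter_upwards [hev] with t ht
    exact (hF.differentiableAt (hW.mem_nhds ht)).comp t (by fun_prop)
  let M : ℂ → Matrix (Fin m) (Fin n) ℂ := fun t => Matrix.of fun l i => Jac F (x₀ + t • e) i l
  let H : ℂ → Matrix (Fin n) (Fin n) ℂ := fun t => gN.g (F (x₀ + t • e))
  have hF0 : F (x₀ + (0 : ℂ) • e) ∈ V := by rw [hline0]; exact hFV hx₀W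
  have hM : ∀ i j, AnalyticAt ℂ (fun t => M t i j) 0 := fun l i =>
    analyticAt_fderiv_line hW (hFi i) hx₀W e (Pi.single l 1)
  have hgN : ∀ i j, ContDiffAt ℝ 2 (fun z => gN.g z i j) (F (x₀ + (0 : ℂ) • e)) := fun i j =>
    ((gN.smooth i j).contDiffAt (hV.mem_nhds hF0)).of_le
      (WithTop.coe_le_coe.2 (le_top : (2 : ℕ∞) ≤ ⊤))
  have hH : ∀ i j, ContDiffAt ℝ 2 (fun t => H t i j) 0 := fun i j =>
    (hgN i j).comp (0 : ℂ) (hcurve.contDiffAt.restrict_scalars ℝ)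
  have hHp : ∀ᶠ t in nhds (0 : ℂ), (H t).PosDef := hev.mono fun t ht => gN.posDef _ (hFV ht)
  have hAG : ∀ᶠ t in nhds (0 : ℂ),
      (M t * H t * (M t).conjTranspose).det = (c : ℂ) * (gM.g (x₀ + t • e)).det := by
    filter_upwards [hev, hHp] with t ht hHt
    have hpb := pullbackMetric_eq gN.g F (x₀ + t • e)
    refine hdet _ _ (hHt.posSemidef.mul_mul_conjTranspose_same _) (gM.posDef _ (hWU ht)) ?_
    intro L K hL hK
    exact hpb ▸ hpres _ ht L K hL hK
  have hA0 : (M 0 * H 0 * (M 0).conjTranspose).det ≠ 0 := by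
    rw [hAG.self_of_nhds]
    refine mul_ne_zero (by exact_mod_cast hc.ne') (gM.posDef _ ?_).det_pos.ne'
    rw [hline0]; exact hx₀
  have hneg : ∀ v : Fin n → ℂ,
      0 ≤ (v ⬝ᵥ (mdz (mdzb H) 0 - mdz H 0 * (H 0)⁻¹ * mdzb H 0).mulVec (star v)).re := by
    intro v
    have := dotProduct_curvature_comp_curve (g := gN.g) hgN hcurve v
    rw [this, Complex.neg_re]
    exact neg_nonneg.2 (hNeg _ hF0 _ _)
  have hmain := re_dz_dzb_log_det_nonneg hH hHp hM hneg hA0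
  have hlog : (fun t => log (M t * H t * (M t).conjTranspose).det) =ᶠ[nhds 0]
      fun t => (Real.log c : ℂ) + log (gM.g (x₀ + t • e)).det := by
    filter_upwards [hAG, hev] with t ht htW
    have := gM.posDef _ (hWU htW)
    rw [ht, Complex.log_ofReal_mul hc this.det_pos.ne']
  rw [hlog.dzb_eventuallyEq.dz_eq, dz_dzb_const_add,
    dz_dzb_comp_curve (f := fun z => log (gM.g z).det)
      (by rw [hline0]; exact contDiffAt_log_det hU gM hx₀) hline] at hmain
  have hder : deriv (fun t : ℂ => x₀ + t • e) 0 = e := by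
    have := ((hasDerivAt_id (0 : ℂ)).smul_const e).const_add x₀
    simpa using this.deriv
  have hpos := hKM x₀ hx₀ e (by simp [he])
  rw [hder, hline0] at hmain
  have : (∑ k, ∑ l, (-(wdz k (fun w => wdzbar l (fun w' => log ((gM.g w').det)) w) x₀))
      * e k * (starRingEnd ℂ) (e l)) =
      -∑ k, ∑ l, wdz k (wdzbar l fun z => log (gM.g z).det) x₀ * e k * star (e l) := by
    simp only [← Finset.sum_neg_distrib]
    refine Finset.sum_congr rfl fun k _ => Finset.sum_congr rfl fun l _ => ?_
    rw [starRingEnd_apply, neg_mul, neg_mul]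
  rw [this, Complex.neg_re] at hpos
  linarith
end
end
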